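/- arXiv:1704.00882 — 4 statements merged into one kernel-verified Lean document; each statement's English description precedes it below -/
import Mathlib

section
/- For every negative integer m and every integer n ≥ 1, N(≤ m+1, n) − M(≤ m, n) = q(−m−1, n) − p(m+2, n). -/
open scoped BigOperators

namespace RankCrank

/-- The `i`-th largest part of a partition (1-indexed); `0` if `i` exceeds
the number of parts. -/
def part {n : ℕ} (l : n.Partition) (i : ℕ) : ℕ :=
  ((l.parts.sort (· ≤ ·)).reverse).getD (i - 1) 0

/-- The rank of a partition: largest part minus number of parts. -/
def rank {n : ℕ} (l : n.Partition) : ℤ :=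
  (part l 1 : ℤ) - l.parts.card

/-- The crank of a partition: the largest part if there are no parts equal to 1,
otherwise the number of parts larger than the number of 1's minus the number of 1's. -/
def crank {n : ℕ} (l : n.Partition) : ℤ :=
  if l.parts.count 1 = 0 then (part l 1 : ℤ)
  else ((l.parts.filter (fun x => l.parts.count 1 < x)).card : ℤ) - l.parts.count 1

/-- `N m n` is the number of partitions of `n` with rank `m`. -/
noncomputable def N (m : ℤ) (n : ℕ) : ℕ :=
  Nat.card {l : n.Partition // rank l = m}

/-- `M m n` is the number of partitions of `n` with crank `m` for `n ≠ 1`, with the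
usual convention for `n = 1`. -/
noncomputable def M (m : ℤ) (n : ℕ) : ℤ :=
  if n = 1 then (if m = 0 then -1 else if m = 1 ∨ m = -1 then 1 else 0)
  else (Nat.card {l : n.Partition // crank l = m} : ℤ)

/-- `Nle m n = N(≤ m, n) = ∑_{r ≤ m} N(r,n)`; since `N(r,n) = 0` for `r < -n`,
the sum may be taken over `-n ≤ r ≤ m`. -/
noncomputable def Nle (m : ℤ) (n : ℕ) : ℤ :=
  ∑ r ∈ Finset.Icc (-(n : ℤ)) m, (N r n : ℤ)

/-- `Mle m n = M(≤ m, n) = ∑_{r ≤ m} M(r,n)`; since `M(r,n) = 0` for `r < -n`,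
the sum may be taken over `-n ≤ r ≤ m`. -/
noncomputable def Mle (m : ℤ) (n : ℕ) : ℤ :=
  ∑ r ∈ Finset.Icc (-(n : ℤ)) m, M r n

/-- The number of partitions of `n`. -/
noncomputable def p (n : ℕ) : ℕ := Nat.card n.Partition

/-- `ospt n = ∑_{m ≥ 0} m M(m,n) - ∑_{m ≥ 0} m N(m,n)`; since ranks and cranks of
partitions of `n` are at most `n`, the sums may be taken over `0 ≤ m ≤ n`. -/
noncomputable def ospt (n : ℕ) : ℤ :=
  (∑ m ∈ Finset.Icc (0 : ℤ) (n : ℤ), m * M m n) -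
    (∑ m ∈ Finset.Icc (0 : ℤ) (n : ℤ), m * (N m n : ℤ))

/-- The rank-set of a partition `λ`:  `{j - λ_{j+1} : 0 ≤ j ≤ ℓ-1} ∪ {j : j ≥ ℓ}`
(note `part l (j+1) = 0` for `j ≥ ℓ`). -/
def rankSet {n : ℕ} (l : n.Partition) : Set ℤ :=
  {x | ∃ j : ℕ, x = (j : ℤ) - (part l (j + 1) : ℤ)}

/-- `q m n` is the number of partitions of `n` whose rank-set contains `m`. -/
noncomputable def q (m : ℤ) (n : ℕ) : ℕ :=
  Nat.card {l : n.Partition // m ∈ rankSet l}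

/-- `prank m n` is the number of partitions of `n` with rank at least `m`. -/
noncomputable def prank (m : ℤ) (n : ℕ) : ℕ :=
  Nat.card {l : n.Partition // m ≤ rank l}

/-- `jm m l` is the number of columns of the `m`-Durfee rectangle of `l`: the largest
`j ≥ 0` with `λ_{m+j} ≥ j`. -/
noncomputable def jm {n : ℕ} (m : ℕ) (l : n.Partition) : ℕ :=
  sSup {j : ℕ | j ≤ part l (m + j)}

/-- The total number of smallest parts in all partitions of `n`. -/
def spt (n : ℕ) : ℕ :=
  ∑ l : n.Partition, l.parts.count ((l.parts.sort (· ≤ ·)).headD 0)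

/-- A bijection `τ` on partitions of `n` nearly preserves the rank–crank
distribution if `crank λ - rank (τ λ)` is `0` when `crank λ = 0`, is `0` or `1`
when `crank λ > 0`, and is `0` or `-1` when `crank λ < 0`. -/
def NearlyPreserves {n : ℕ} (τ : n.Partition ≃ n.Partition) : Prop :=
  ∀ l : n.Partition,
    (crank l = 0 → crank l - rank (τ l) = 0) ∧
    (0 < crank l → crank l - rank (τ l) = 0 ∨ crank l - rank (τ l) = 1) ∧
    (crank l < 0 → crank l - rank (τ l) = 0 ∨ crank l - rank (τ l) = -1)

end RankCrank

namespace RankCrank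

open Finset

/-- The number of elements of a multiset that are at least `t`. -/
def countGe (s : Multiset ℕ) (t : ℕ) : ℕ :=
  s.countP (t ≤ ·)

lemma countGe_cons (a : ℕ) (s : Multiset ℕ) (t : ℕ) :
    countGe (a ::ₘ s) t = countGe s t + if t ≤ a then 1 else 0 :=
  Multiset.countP_cons _ _ _

lemma countGe_add (s u : Multiset ℕ) (t : ℕ) :
    countGe (s + u) t = countGe s t + countGe u t :=
  Multiset.countP_add _ _ _

lemma countGe_replicate_one (v : ℕ) {t : ℕ} (ht : 2 ≤ t) :
    countGe (Multiset.replicate v 1) t = 0 := by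
  refine Multiset.countP_eq_zero.2 fun a ha => ?_
  rw [Multiset.eq_of_mem_replicate ha]
  omega

lemma countGe_eq_count_add (s : Multiset ℕ) (t : ℕ) :
    countGe s t = s.count t + countGe s (t + 1) := by
  induction s using Multiset.induction_on with
  | empty => simp [countGe]
  | cons a s ih =>
    rw [countGe_cons, countGe_cons, Multiset.count_cons, ih]
    split_ifs <;> omega

lemma countGe_antitone (s : Multiset ℕ) : Antitone (countGe s) :=
  antitone_nat_of_succ_le fun t => by
    rw [countGe_eq_count_add s t]
    omega

lemma countGe_eq_zero {n : ℕ} (l : n.Partition) {t : ℕ} (ht : n < t) :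
    countGe l.parts t = 0 :=
  Multiset.countP_eq_zero.2 fun a ha => by
    have := Nat.Partition.le_of_mem_parts ha
    omega

lemma sum_countGe {n : ℕ} (s : Multiset ℕ) (hs : ∀ a ∈ s, a ≤ n) :
    ∑ t ∈ Icc 1 n, countGe s t = s.sum := by
  induction s using Multiset.induction_on with
  | empty => simp [countGe]
  | cons a s ih =>
    have ha : a ≤ n := hs a (Multiset.mem_cons_self a s)
    have hf : (Icc 1 n).filter (· ≤ a) = Icc 1 a := by
      ext t
      simp only [mem_filter, mem_Icc]
      omega
    simp_rw [countGe_cons]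
    rw [sum_add_distrib, ih fun b hb => hs b (Multiset.mem_cons_of_mem hb), sum_boole, hf,
      Multiset.sum_cons]
    simp [add_comm]

lemma le_getD_iff_of_sorted {L : List ℕ} (hL : L.Pairwise (· ≥ ·)) {j : ℕ} (hj : 1 ≤ j) (i : ℕ) :
    j ≤ L.getD i 0 ↔ i < L.countP (j ≤ ·) := by
  induction L generalizing i with
  | nil => simp; omega
  | cons a L ih =>
    rw [List.pairwise_cons] at hL
    rw [List.countP_cons]
    by_cases hja : j ≤ a
    · cases i with
      | zero => simp [hja]
      | succ i => simpa [hja] using ih hL.2 i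
    · have h0 : L.countP (j ≤ ·) = 0 := by
        refine List.countP_eq_zero.2 fun b hb => ?_
        have := hL.1 b hb
        simp only [decide_eq_true_eq]
        omega
      cases i with
      | zero => simpa [hja] using h0
      | succ i => simpa [hja, h0] using ih hL.2 i

lemma le_part_iff {n : ℕ} (l : n.Partition) {i j : ℕ} (hi : 1 ≤ i) (hj : 1 ≤ j) :
    j ≤ part l i ↔ i ≤ countGe l.parts j := by
  have hs : ((l.parts.sort (· ≤ ·)).reverse).Pairwise (· ≥ ·) := by
    rw [List.pairwise_reverse]
    exact l.parts.pairwise_sort (· ≤ ·)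
  have hc : ((l.parts.sort (· ≤ ·)).reverse).countP (j ≤ ·) = countGe l.parts j := by
    rw [List.countP_reverse, ← Multiset.coe_countP, Multiset.sort_eq, countGe]
  rw [part, le_getD_iff_of_sorted hs hj, hc]
  omega

/-- The conjugate of a partition. -/
def conj {n : ℕ} (l : n.Partition) : n.Partition :=
  Nat.Partition.ofSums n ((Icc 1 n).val.map (countGe l.parts))
    (by rw [Finset.sum_map_val, sum_countGe l.parts fun _ ha => Nat.Partition.le_of_mem_parts ha,
      l.parts_sum])

lemma countGe_conj {n : ℕ} (l : n.Partition) {j : ℕ} (hj : 1 ≤ j) :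
    countGe (conj l).parts j = #{t ∈ Icc 1 n | j ≤ countGe l.parts t} := by
  rw [conj, Nat.Partition.ofSums_parts, countGe, Multiset.countP_filter, Multiset.countP_map]
  refine congrArg Multiset.card (Multiset.filter_congr fun t _ => ?_)
  omega

lemma part_conj {n : ℕ} (l : n.Partition) {i : ℕ} (hi : 1 ≤ i) :
    part (conj l) i = countGe l.parts i := by
  have key : ∀ j, 1 ≤ j → (j ≤ part (conj l) i ↔ j ≤ countGe l.parts i) := by
    intro j hj
    rw [le_part_iff _ hi hj, countGe_conj l hj]
    constructor
    · intro h
      by_contra hlt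
      have hsub : {t ∈ Icc 1 n | j ≤ countGe l.parts t} ⊆ Ico 1 i := by
        intro t ht
        rw [mem_filter, mem_Icc] at ht
        rw [mem_Ico]
        refine ⟨ht.1.1, lt_of_not_ge fun hit => ?_⟩
        have := countGe_antitone l.parts hit
        omega
      have := card_le_card hsub
      rw [Nat.card_Ico] at this
      omega
    · intro h
      have hin : i ≤ n := by
        by_contra hlt
        have := countGe_eq_zero l (not_le.1 hlt)
        omega
      have hsub : Icc 1 i ⊆ {t ∈ Icc 1 n | j ≤ countGe l.parts t} := by
        intro t ht
        rw [mem_Icc] at ht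
        rw [mem_filter, mem_Icc]
        exact ⟨⟨ht.1, ht.2.trans hin⟩, h.trans (countGe_antitone l.parts ht.2)⟩
      simpa using card_le_card hsub
  have h1 := key (part (conj l) i)
  have h2 := key (countGe l.parts i)
  omega

lemma conj_injective {n : ℕ} : Function.Injective (conj (n := n)) := by
  intro l l' h
  have hc : ∀ t, 1 ≤ t → countGe l.parts t = countGe l'.parts t := fun t ht => by
    rw [← part_conj l ht, ← part_conj l' ht, h]
  refine Nat.Partition.ext (Multiset.ext.2 fun t => ?_)
  rcases Nat.eq_zero_or_pos t with rfl | ht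
  · rw [Multiset.count_eq_zero_of_notMem fun h0 => (l.parts_pos h0).ne rfl,
      Multiset.count_eq_zero_of_notMem fun h0 => (l'.parts_pos h0).ne rfl]
  · have h1 := countGe_eq_count_add l.parts t
    have h2 := countGe_eq_count_add l'.parts t
    rw [hc t ht, hc (t + 1) (by omega)] at h1
    omega

lemma neg_mem_rankSet_iff {n : ℕ} (l : n.Partition) (k : ℕ) :
    (-(k : ℤ) - 1) ∈ rankSet l ↔ ∃ j : ℕ, part l (j + 1) = k + j + 1 := by
  refine exists_congr fun j => ?_
  omega

lemma natCast_notMem_rankSet_iff {n : ℕ} (l : n.Partition) (k : ℕ) :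
    (k : ℤ) ∉ rankSet l ↔ (-(k : ℤ) - 1) ∈ rankSet (conj l) := by
  rw [neg_mem_rankSet_iff]
  constructor
  · intro h
    have hex : ∃ e, countGe l.parts (e + 1) < k + e + 1 := by
      refine ⟨countGe l.parts 0, ?_⟩
      have := countGe_antitone l.parts (Nat.zero_le (countGe l.parts 0 + 1))
      omega
    classical
    obtain ⟨e, he, hmin⟩ : ∃ e, countGe l.parts (e + 1) < k + e + 1 ∧
        ∀ d < e, ¬ countGe l.parts (d + 1) < k + d + 1 :=
      ⟨Nat.find hex, Nat.find_spec hex, fun d hd => Nat.find_min hex hd⟩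
    have hne : part l (k + e + 1) ≠ e := fun h' => h ⟨k + e, by rw [h']; push_cast; ring⟩
    have hle : ¬ e + 1 ≤ part l (k + e + 1) := by
      rw [le_part_iff l (by omega) (by omega)]
      omega
    cases e with
    | zero => omega
    | succ d =>
      have h1 : ¬ d + 1 ≤ part l (k + (d + 1) + 1) := by omega
      rw [le_part_iff l (by omega) (by omega)] at h1
      have h2 := hmin d (by omega)
      exact ⟨d, by rw [part_conj l (by omega)]; omega⟩
  · rintro ⟨j, hj⟩ ⟨i, hi⟩
    rw [part_conj l (by omega)] at hj
    have := le_part_iff l (i := i + 1) (j := j + 1) (by omega) (by omega)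
    omega

lemma neg_mem_rankSet_iff_countGe {n : ℕ} (l : n.Partition) (k : ℕ) :
    (-(k : ℤ) - 1) ∈ rankSet l ↔
      ∃ v, countGe l.parts (v + 1) + k + 1 ≤ v ∧ v ≤ countGe l.parts v + k := by
  rw [neg_mem_rankSet_iff]
  constructor
  · rintro ⟨j, hj⟩
    have h1 := le_part_iff l (i := j + 1) (j := k + j + 1) (by omega) (by omega)
    have h2 := le_part_iff l (i := j + 1) (j := k + j + 1 + 1) (by omega) (by omega)
    exact ⟨k + j + 1, by omega, by omega⟩
  · rintro ⟨v, h1, h2⟩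
    obtain ⟨j, rfl⟩ : ∃ j, v = k + j + 1 := ⟨v - k - 1, by omega⟩
    refine ⟨j, ?_⟩
    have h3 := le_part_iff l (i := j + 1) (j := k + j + 1) (by omega) (by omega)
    have h4 := le_part_iff l (i := j + 1) (j := k + j + 1 + 1) (by omega) (by omega)
    omega

lemma crank_le_neg_iff {n : ℕ} (l : n.Partition) (k : ℕ) :
    crank l ≤ -(k : ℤ) - 1 ↔
      countGe l.parts (l.parts.count 1 + 1) + k + 1 ≤ l.parts.count 1 := by
  have hc : (l.parts.filter (fun x => l.parts.count 1 < x)).card =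
      countGe l.parts (l.parts.count 1 + 1) :=
    (Multiset.countP_eq_card_filter _ _).symm
  rw [crank, hc]
  split_ifs <;> omega

/-- Trading `v` ones for one part equal to `v`. -/
lemma card_trade_ones (n k : ℕ) {v : ℕ} (hv : 1 ≤ v) :
    #{l : n.Partition | v ≤ l.parts.count 1 ∧ countGe l.parts (v + 1) + k + 1 ≤ v ∧
        v ≤ countGe l.parts v + k + 1} =
      #{l : n.Partition | countGe l.parts (v + 1) + k + 1 ≤ v ∧ v ≤ countGe l.parts v + k} := by
  have hsub : ∀ s : Multiset ℕ, v ≤ s.count 1 →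
      s - Multiset.replicate v 1 + Multiset.replicate v 1 = s := fun s hs =>
    tsub_add_cancel_of_le (Multiset.le_count_iff_replicate_le.1 hs)
  have hmem : ∀ l : n.Partition, countGe l.parts (v + 1) + k + 1 ≤ v →
      v ≤ countGe l.parts v + k → v ∈ l.parts := by
    intro l h1 h2
    have := countGe_eq_count_add l.parts v
    exact Multiset.count_pos.1 (by omega)
  refine card_bij'
    (fun l hl => ⟨v ::ₘ (l.parts - Multiset.replicate v 1), ?_, ?_⟩)
    (fun l hl => ⟨l.parts.erase v + Multiset.replicate v 1, ?_, ?_⟩) ?_ ?_ ?_ ?_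
  · intro i hi
    rcases Multiset.mem_cons.1 hi with rfl | hi
    · exact hv
    · exact l.parts_pos (Multiset.mem_of_le tsub_le_self hi)
  · have h := congrArg Multiset.sum (hsub l.parts (mem_filter.1 hl).2.1)
    rw [Multiset.sum_add, Multiset.sum_replicate, l.parts_sum] at h
    simp only [smul_eq_mul, mul_one] at h
    rw [Multiset.sum_cons]
    omega
  · intro i hi
    rcases Multiset.mem_add.1 hi with hi | hi
    · exact l.parts_pos (Multiset.mem_of_mem_erase hi)
    · rw [Multiset.eq_of_mem_replicate hi]
      exact one_pos
  · obtain ⟨-, h1, h2⟩ := mem_filter.1 hl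
    have h := congrArg Multiset.sum (Multiset.cons_erase (hmem l h1 h2))
    rw [Multiset.sum_cons, l.parts_sum] at h
    rw [Multiset.sum_add, Multiset.sum_replicate, smul_eq_mul, mul_one]
    omega
  · intro l hl
    obtain ⟨-, h0, h1, h2⟩ := mem_filter.1 hl
    have hc : ∀ t, 2 ≤ t →
        countGe (l.parts - Multiset.replicate v 1) t = countGe l.parts t := fun t ht => by
      conv_rhs => rw [← hsub l.parts h0, countGe_add, countGe_replicate_one v ht, add_zero]
    rw [mem_filter]
    refine ⟨mem_univ _, ?_, ?_⟩
    · simpa [countGe_cons, hc (v + 1) (by omega)] using h1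
    · simp only [countGe_cons, le_refl, if_true]
      rcases hv.eq_or_lt with rfl | hv2
      · omega
      · rw [hc v hv2]
        omega
  · intro l hl
    obtain ⟨-, h1, h2⟩ := mem_filter.1 hl
    have hc : ∀ t, 2 ≤ t → countGe l.parts t =
        countGe (l.parts.erase v + Multiset.replicate v 1) t + if t ≤ v then 1 else 0 :=
      fun t ht => by
        rw [countGe_add, countGe_replicate_one v ht, add_zero, ← countGe_cons,
          Multiset.cons_erase (hmem l h1 h2)]
    rw [mem_filter]
    refine ⟨mem_univ _, by simp, ?_, ?_⟩
    · have := hc (v + 1) (by omega)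
      simp only [add_le_iff_nonpos_right, nonpos_iff_eq_zero, one_ne_zero, if_false] at this
      dsimp only
      omega
    · dsimp only
      rcases hv.eq_or_lt with rfl | hv2
      · omega
      · have := hc v hv2
        rw [if_pos le_rfl] at this
        omega
  · intro l hl
    refine Nat.Partition.ext ?_
    simpa using hsub l.parts (mem_filter.1 hl).2.1
  · intro l hl
    obtain ⟨-, h1, h2⟩ := mem_filter.1 hl
    refine Nat.Partition.ext ?_
    simpa using Multiset.cons_erase (hmem l h1 h2)

lemma count_one_le {n : ℕ} (l : n.Partition) : l.parts.count 1 ≤ n := by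
  have h := Multiset.le_count_iff_replicate_le.1 (le_refl (l.parts.count 1))
  obtain ⟨u, hu⟩ := Multiset.le_iff_exists_add.1 h
  have := congrArg Multiset.sum hu
  rw [l.parts_sum, Multiset.sum_add, Multiset.sum_replicate, smul_eq_mul, mul_one] at this
  omega

open Classical in
/-- For negative `m = -k - 1`, as many partitions have crank at most `m` as have `m` in their
rank-set. -/
lemma card_crank_le_neg (n k : ℕ) :
    #{l : n.Partition | crank l ≤ -(k : ℤ) - 1} =
      #{l : n.Partition | (-(k : ℤ) - 1) ∈ rankSet l} := by
  let X : ℕ → Finset n.Partition := fun w =>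
    {l | w ≤ l.parts.count 1 ∧ countGe l.parts (w + 1) + k + 1 ≤ w}
  let X' : ℕ → Finset n.Partition := fun w =>
    {l | w + 1 ≤ l.parts.count 1 ∧ countGe l.parts (w + 1) + k + 1 ≤ w}
  let Y : ℕ → Finset n.Partition := fun w =>
    {l | countGe l.parts (w + 1 + 1) + k + 1 ≤ w + 1 ∧ w + 1 ≤ countGe l.parts (w + 1) + k}
  have hX'X : ∀ w, X' w ⊆ X w := fun w l hl => by
    simp only [X, X', mem_filter] at hl ⊢
    exact ⟨hl.1, by omega, hl.2.2⟩
  have hX'X1 : ∀ w, X' w ⊆ X (w + 1) := fun w l hl => by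
    simp only [X, X', mem_filter] at hl ⊢
    have := countGe_antitone l.parts (Nat.le_succ (w + 1))
    exact ⟨hl.1, hl.2.1, by simp only [Nat.succ_eq_add_one] at this; omega⟩
  have hcrank : #{l : n.Partition | crank l ≤ -(k : ℤ) - 1} =
      ∑ w ∈ range (n + 1), #(X w \ X' w) := by
    rw [card_eq_sum_card_fiberwise (f := fun l => l.parts.count 1) (t := range (n + 1))
      fun l _ => by simpa [Nat.lt_succ_iff] using count_one_le l]
    refine sum_congr rfl fun w _ => congrArg card ?_
    ext l
    simp only [X, X', mem_filter, mem_sdiff, mem_univ, true_and, crank_le_neg_iff]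
    constructor
    · rintro ⟨h, rfl⟩
      exact ⟨⟨le_rfl, h⟩, by omega⟩
    · rintro ⟨⟨h1, h2⟩, h3⟩
      obtain rfl : l.parts.count 1 = w := by omega
      exact ⟨h2, rfl⟩
  have hrank : #{l : n.Partition | (-(k : ℤ) - 1) ∈ rankSet l} = ∑ w ∈ range n, #(Y w) := by
    rw [← card_biUnion]
    · refine congrArg card ?_
      ext l
      simp only [Y, mem_filter, mem_univ, true_and, mem_biUnion, mem_range,
        neg_mem_rankSet_iff_countGe]
      constructor
      · rintro ⟨v, h1, h2⟩
        have hvn : v ≤ n := by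
          by_contra hlt
          have := countGe_eq_zero l (not_le.1 hlt)
          omega
        obtain ⟨w, rfl⟩ : ∃ w, v = w + 1 := ⟨v - 1, by omega⟩
        exact ⟨w, hvn, h1, h2⟩
      · rintro ⟨w, -, h⟩
        exact ⟨w + 1, h⟩
    · have hlt : ∀ w w', w < w' → Disjoint (Y w) (Y w') := by
        intro w w' hw
        rw [disjoint_left]
        intro l h1 h2
        simp only [Y, mem_filter] at h1 h2
        have := countGe_antitone l.parts (show w + 1 + 1 ≤ w' + 1 by omega)
        omega
      intro w _ w' _ hne
      rcases hne.lt_or_gt with h | h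
      · exact hlt _ _ h
      · exact (hlt _ _ h).symm
  have hXY : ∀ w, #(X (w + 1) \ X' w) = #(Y w) := by
    intro w
    rw [← card_trade_ones n k (show 1 ≤ w + 1 by omega)]
    refine congrArg card ?_
    ext l
    simp only [X, X', mem_filter, mem_sdiff, mem_univ, true_and]
    omega
  have hX0 : #(X 0) = 0 := by
    simp [X]
  have hXn : #(X' n) = 0 := by
    refine card_eq_zero.2 (filter_eq_empty_iff.2 fun l _ => ?_)
    have := count_one_le l
    omega
  have h1 : ∀ w, #(X w \ X' w) + #(X' w) = #(X w) := fun w =>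
    card_sdiff_add_card_eq_card (hX'X w)
  have h2 : ∀ w, #(Y w) + #(X' w) = #(X (w + 1)) := fun w => by
    rw [← hXY, card_sdiff_add_card_eq_card (hX'X1 w)]
  have s1 : ∑ w ∈ range (n + 1), #(X w \ X' w) + ∑ w ∈ range (n + 1), #(X' w) =
      ∑ w ∈ range (n + 1), #(X w) := by
    rw [← sum_add_distrib]
    exact sum_congr rfl fun w _ => h1 w
  have s2 : ∑ w ∈ range n, #(Y w) + ∑ w ∈ range n, #(X' w) =
      ∑ w ∈ range n, #(X (w + 1)) := by
    rw [← sum_add_distrib]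
    exact sum_congr rfl fun w _ => h2 w
  rw [sum_range_succ (fun w => #(X' w)), sum_range_succ' (fun w => #(X w)), hX0, hXn] at s1
  rw [hcrank, hrank]
  omega

open Classical in
lemma card_neg_mem_rankSet_add_q (n k : ℕ) :
    #{l : n.Partition | (-(k : ℤ) - 1) ∈ rankSet l} + q k n = Fintype.card n.Partition := by
  have hconj : #{l : n.Partition | (-(k : ℤ) - 1) ∈ rankSet l} =
      #{l : n.Partition | ¬ (k : ℤ) ∈ rankSet l} := by
    symm
    refine card_bijective conj (Finite.injective_iff_bijective.1 conj_injective) fun l => ?_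
    simp only [mem_filter, mem_univ, true_and]
    exact natCast_notMem_rankSet_iff l k
  rw [hconj, q, Nat.card_eq_fintype_card, Fintype.card_subtype, add_comm,
    card_filter_add_card_filter_not, card_univ]

lemma natCard_fiber {n : ℕ} (f : n.Partition → ℤ) (r : ℤ) :
    Nat.card {l : n.Partition // f l = r} = #{l : n.Partition | f l = r} := by
  rw [Nat.card_eq_fintype_card, Fintype.card_subtype]

lemma sum_natCard_fiber {n : ℕ} (f : n.Partition → ℤ) (hf : ∀ l, -(n : ℤ) ≤ f l) (m : ℤ) :
    ∑ r ∈ Icc (-(n : ℤ)) m, Nat.card {l : n.Partition // f l = r} =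
      #{l : n.Partition | f l ≤ m} := by
  rw [card_eq_sum_card_fiberwise (f := f) (t := Icc (-(n : ℤ)) m) fun l hl => by
    simpa [hf l] using hl]
  refine sum_congr rfl fun r hr => ?_
  rw [natCard_fiber, filter_filter]
  refine congrArg card (filter_congr fun l _ => ?_)
  rw [mem_Icc] at hr
  omega

lemma card_parts_le {n : ℕ} (l : n.Partition) : l.parts.card ≤ n := by
  have := Multiset.card_nsmul_le_sum (s := l.parts) (a := 1) fun x hx => l.parts_pos hx
  simpa [l.parts_sum] using this

lemma neg_le_rank {n : ℕ} (l : n.Partition) : -(n : ℤ) ≤ rank l := by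
  have := card_parts_le l
  rw [rank]
  omega

lemma neg_le_crank {n : ℕ} (l : n.Partition) : -(n : ℤ) ≤ crank l := by
  have := count_one_le l
  rw [crank]
  split_ifs <;> omega

lemma M_of_neg {r : ℤ} (hr : r < 0) (n : ℕ) :
    M r n = (Nat.card {l : n.Partition // crank l = r} : ℤ) := by
  by_cases hn : n = 1
  · subst hn
    have hc : ∀ l : Nat.Partition 1, crank l = -1 := fun l => by simp [crank]
    rw [M, if_pos rfl, natCard_fiber]
    by_cases h : r = -1
    · subst h
      simp [hc]
    · have : #{l : Nat.Partition 1 | crank l = r} = 0 := by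
        refine card_eq_zero.2 (filter_eq_empty_iff.2 fun l _ => ?_)
        rw [hc l]
        exact fun h' => h h'.symm
      rw [this, if_neg (by omega), if_neg (by omega), Nat.cast_zero]
  · rw [M, if_neg hn]

lemma Nle_add_prank (m : ℤ) (n : ℕ) :
    Nle m n + prank (m + 1) n = Fintype.card n.Partition := by
  have h : prank (m + 1) n = #{l : n.Partition | ¬ rank l ≤ m} := by
    rw [prank, Nat.card_eq_fintype_card, Fintype.card_subtype]
    refine congrArg card (filter_congr fun l _ => ?_)
    omega
  rw [Nle, h]
  simp only [N]
  rw [← Nat.cast_sum, sum_natCard_fiber rank neg_le_rank, ← Nat.cast_add,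
    card_filter_add_card_filter_not, card_univ]

lemma Mle_of_neg {m : ℤ} (hm : m < 0) (n : ℕ) :
    Mle m n = #{l : n.Partition | crank l ≤ m} := by
  rw [← sum_natCard_fiber crank neg_le_crank, Nat.cast_sum]
  refine sum_congr rfl fun r hr => M_of_neg ?_ n
  rw [mem_Icc] at hr
  omega

end RankCrank

open RankCrank in
/-- For every negative integer `m` and every `n ≥ 1`,
`N(≤ m+1, n) - M(≤ m, n) = q(-m-1, n) - p(m+2, n)`. -/
theorem Nle_sub_Mle (m : ℤ) (hm : m < 0) (n : ℕ) (hn : 1 ≤ n) :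
    Nle (m + 1) n - Mle m n = (q (-m - 1) n : ℤ) - (prank (m + 2) n : ℤ) := by
  obtain ⟨k, rfl⟩ : ∃ k : ℕ, m = -(k : ℤ) - 1 := ⟨(-m - 1).toNat, by omega⟩
  have h1 := Nle_add_prank (-(k : ℤ) - 1 + 1) n
  have h2 := Mle_of_neg hm n
  have h3 := card_neg_mem_rankSet_add_q n k
  rw [← card_crank_le_neg] at h3
  rw [show -(-(k : ℤ) - 1) - 1 = k by ring, show -(k : ℤ) - 1 + 2 = -(k : ℤ) - 1 + 1 + 1 by ring]
  omega
end

section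
/- For every integer m ≥ 0 and every integer n ≥ 1, q(m, n) ≥ p(−m+1, n); that is, the number of partitions of n whose rank-set contains m is at least the number of partitions of n with rank greater than or equal to −m+1. -/
open scoped BigOperators

namespace RankCrank

/-- The partitions of `n`, written as weakly decreasing sequences that end in zeros. -/
def seqs (n : ℕ) : Set (ℕ → ℕ) :=
  {a | Antitone a ∧ ∃ K₀, ∀ K, K₀ ≤ K → ∑ i ∈ Finset.range K, a i = n}

/-- The sequences of partitions of `n` with rank at most `-m`. -/
def lowRank (m n : ℕ) : Set (ℕ → ℕ) :=
  {a ∈ seqs n | ∀ i, i < a 0 + m → a i ≠ 0}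

/-- The sequences of partitions of `n` whose rank-set omits `m`. -/
def omitting (m n : ℕ) : Set (ℕ → ℕ) :=
  {a ∈ seqs n | ∀ i, a i + m ≠ i}

/-- The parts of a partition as a weakly decreasing list. -/
def partList {n : ℕ} (l : n.Partition) : List ℕ :=
  (l.parts.sort (· ≤ ·)).reverse

/-- The parts of a partition as a weakly decreasing sequence that ends in zeros. -/
def toSeq {n : ℕ} (l : n.Partition) (i : ℕ) : ℕ :=
  (partList l).getD i 0

lemma part_succ {n : ℕ} (l : n.Partition) (i : ℕ) : part l (i + 1) = toSeq l i := rfl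

lemma coe_partList {n : ℕ} (l : n.Partition) : (partList l : Multiset ℕ) = l.parts := by
  rw [partList, Multiset.coe_reverse, Multiset.sort_eq]

lemma ne_zero_of_mem_partList {n : ℕ} {l : n.Partition} {x : ℕ} (hx : x ∈ partList l) :
    x ≠ 0 := by
  rw [← Multiset.mem_coe, coe_partList] at hx
  exact (l.parts_pos hx).ne'

lemma pairwise_partList {n : ℕ} (l : n.Partition) : (partList l).Pairwise (· ≥ ·) := by
  rw [partList, List.pairwise_reverse]
  exact Multiset.pairwise_sort _ _

lemma toSeq_ne_zero_iff {n : ℕ} (l : n.Partition) (i : ℕ) :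
    toSeq l i ≠ 0 ↔ i < l.parts.card := by
  have hc : l.parts.card = (partList l).length := by rw [← coe_partList, Multiset.coe_card]
  rw [hc, toSeq]
  by_cases h : i < (partList l).length
  · rw [List.getD_eq_getElem _ _ h]
    exact ⟨fun _ => h, fun _ => ne_zero_of_mem_partList (List.getElem_mem h)⟩
  · rw [List.getD_eq_default _ _ (by omega)]
    simp [h]

lemma sum_range_getD (L : List ℕ) (K : ℕ) (hK : L.length ≤ K) :
    ∑ i ∈ Finset.range K, L.getD i 0 = L.sum := by
  induction L generalizing K with
  | nil => simp
  | cons x L ih =>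
    obtain ⟨K, rfl⟩ : ∃ k, K = k + 1 := ⟨K - 1, by simp at hK; omega⟩
    rw [Finset.sum_range_succ']
    simp only [List.getD_cons_succ, List.getD_cons_zero, List.sum_cons]
    rw [ih K (by simpa using hK), add_comm]

lemma toSeq_mem_seqs {n : ℕ} (l : n.Partition) : toSeq l ∈ seqs n := by
  refine ⟨fun i j hij => ?_, (partList l).length, fun K hK => ?_⟩
  · unfold toSeq
    by_cases h : j < (partList l).length
    · rw [List.getD_eq_getElem _ _ h, List.getD_eq_getElem _ _ (hij.trans_lt h)]
      rcases hij.eq_or_lt with rfl | hlt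
      · rfl
      · exact List.pairwise_iff_getElem.mp (pairwise_partList l) _ _ _ _ hlt
    · rw [List.getD_eq_default _ _ (by omega)]
      exact Nat.zero_le _
  · have hsum : (partList l).sum = n := by
      rw [← Multiset.sum_coe, coe_partList, l.parts_sum]
    exact (sum_range_getD _ _ hK).trans hsum

lemma toSeq_injective (n : ℕ) : Function.Injective (toSeq : n.Partition → ℕ → ℕ) := by
  intro l l' h
  have hlen : (partList l).length = (partList l').length := by
    rw [← Multiset.coe_card, ← Multiset.coe_card, coe_partList, coe_partList]
    have key (i : ℕ) : i < l.parts.card ↔ i < l'.parts.card := by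
      rw [← toSeq_ne_zero_iff, ← toSeq_ne_zero_iff, h]
    have h₁ := key l.parts.card
    have h₂ := key l'.parts.card
    omega
  have hL : partList l = partList l' := by
    refine List.ext_getElem hlen fun i h₁ h₂ => ?_
    have := congrFun h i
    rwa [toSeq, toSeq, List.getD_eq_getElem _ _ h₁, List.getD_eq_getElem _ _ h₂] at this
  apply Nat.Partition.ext
  rw [← coe_partList, ← coe_partList, hL]

lemma exists_ne_zero_iff_lt {n : ℕ} {a : ℕ → ℕ} (ha : a ∈ seqs n) :
    ∃ k, ∀ i, a i ≠ 0 ↔ i < k := by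
  obtain ⟨hanti, K, hK⟩ := ha
  have hex : ∃ k, a k = 0 := by
    refine ⟨K, ?_⟩
    have h₁ := hK K le_rfl
    have h₂ := hK (K + 1) (by omega)
    rw [Finset.sum_range_succ] at h₂
    omega
  refine ⟨Nat.find hex, fun i => ⟨fun hi => ?_, fun hi => Nat.find_min hex hi⟩⟩
  by_contra! hlt
  have h₁ := hanti hlt
  have h₂ := Nat.find_spec hex
  omega

lemma exists_toSeq_eq {n : ℕ} {a : ℕ → ℕ} (ha : a ∈ seqs n) :
    ∃ l : n.Partition, toSeq l = a := by
  obtain ⟨k, hk⟩ := exists_ne_zero_iff_lt ha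
  obtain ⟨hanti, K, hK⟩ := ha
  set L := (List.range k).map a with hLdef
  have hget (i : ℕ) : L.getD i 0 = a i := by
    by_cases hi : i < k
    · rw [List.getD_eq_getElem _ _ (by simpa [hLdef] using hi)]
      simp [hLdef]
    · rw [List.getD_eq_default _ _ (by simpa [hLdef] using hi)]
      by_contra h
      exact hi ((hk i).mp (Ne.symm h))
  have hsum : L.sum = n := by
    rw [← hK (max K L.length) (le_max_left _ _), ← sum_range_getD L _ (le_max_right _ _)]
    exact Finset.sum_congr rfl fun i _ => hget i
  have hpw : L.Pairwise (· ≥ ·) := by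
    rw [hLdef, List.pairwise_map]
    exact List.pairwise_lt_range.imp fun h => hanti h.le
  let l : n.Partition :=
    { parts := L
      parts_pos := by
        intro x hx
        rw [Multiset.mem_coe, hLdef, List.mem_map] at hx
        obtain ⟨i, hi, rfl⟩ := hx
        exact Nat.pos_of_ne_zero ((hk i).mpr (List.mem_range.mp hi))
      parts_sum := by rw [Multiset.sum_coe, hsum] }
  have hl : partList l = L := by
    have hperm : (partList l).Perm L := Multiset.coe_eq_coe.mp (coe_partList l)
    exact hperm.eq_of_pairwise (fun _ _ _ _ h₁ h₂ => le_antisymm h₂ h₁)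
      (pairwise_partList l) hpw
  refine ⟨l, funext fun i => ?_⟩
  rw [toSeq, hl, hget]

lemma seqs_finite (n : ℕ) : (seqs n).Finite :=
  (Set.finite_range (toSeq : n.Partition → ℕ → ℕ)).subset fun _ ha => exists_toSeq_eq ha

/-- Counting partitions amounts to counting their sequences. -/
lemma card_partition_eq_ncard {n : ℕ} {P : n.Partition → Prop} {Q : (ℕ → ℕ) → Prop}
    (h : ∀ l, P l ↔ Q (toSeq l)) :
    Nat.card {l : n.Partition // P l} = {a ∈ seqs n | Q a}.ncard := by
  have himage : {a ∈ seqs n | Q a} = toSeq '' {l : n.Partition | P l} := by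
    ext a
    constructor
    · rintro ⟨ha, hQ⟩
      obtain ⟨l, rfl⟩ := exists_toSeq_eq ha
      exact ⟨l, (h l).mpr hQ, rfl⟩
    · rintro ⟨l, hl, rfl⟩
      exact ⟨toSeq_mem_seqs l, (h l).mp hl⟩
  rw [himage, Set.ncard_image_of_injective _ (toSeq_injective n)]
  exact Nat.card_coe_set_eq {l : n.Partition | P l}

lemma ncard_sep_add_ncard_sep_not (n : ℕ) (Q : (ℕ → ℕ) → Prop) :
    {a ∈ seqs n | Q a}.ncard + {a ∈ seqs n | ¬ Q a}.ncard = (seqs n).ncard :=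
  Set.ncard_inter_add_ncard_sdiff_eq_ncard (seqs n) {a | Q a} (seqs_finite n)

lemma prank_add_ncard_lowRank (m n : ℕ) :
    prank (-(m : ℤ) + 1) n + (lowRank m n).ncard = (seqs n).ncard := by
  rw [prank, card_partition_eq_ncard (Q := fun a => ¬ ∀ i, i < a 0 + m → a i ≠ 0), add_comm]
  · exact ncard_sep_add_ncard_sep_not n _
  · intro l
    have hlow : (∀ i, i < toSeq l 0 + m → toSeq l i ≠ 0) ↔ toSeq l 0 + m ≤ l.parts.card := by
      simp only [toSeq_ne_zero_iff]
      exact ⟨fun h => by by_contra! hc; exact lt_irrefl _ (h _ hc), fun h i hi => hi.trans_le h⟩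
    rw [hlow, rank, show part l 1 = toSeq l 0 from rfl]
    omega

lemma q_add_ncard_omitting (m n : ℕ) :
    q (m : ℤ) n + (omitting m n).ncard = (seqs n).ncard := by
  rw [q, card_partition_eq_ncard (Q := fun a => ¬ ∀ i, a i + m ≠ i), add_comm]
  · exact ncard_sep_add_ncard_sep_not n _
  · intro l
    simp only [rankSet, Set.mem_ofPred_eq, part_succ, not_forall, not_not]
    exact exists_congr fun i => by omega

lemma sum_range_ite_lt {k T : ℕ} (h : k ≤ T) :
    ∑ i ∈ Finset.range T, (if i < k then 1 else 0) = k := by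
  rw [← Finset.sum_filter, Finset.sum_const, smul_eq_mul, mul_one,
    show (Finset.range T).filter (· < k) = Finset.range k by ext i; simp; omega,
    Finset.card_range]

/-- Dyson's adjoint: trade the first column, of length `k`, for a row of length `k - m - 1`. -/
lemma ncard_lowRank_add (m N : ℕ) :
    (lowRank m (N + m + 1)).ncard + (lowRank (m + 3) N).ncard = (seqs N).ncard := by
  rw [← ncard_sep_add_ncard_sep_not N (fun a => ∀ i, i < a 0 + (m + 3) → a i ≠ 0), add_comm]
  congr 1
  symm
  refine Set.ncard_congr (fun a _ i => if i < a 0 + m + 1 then a (i + 1) + 1 else 0) ?_ ?_ ?_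
  · rintro a ⟨⟨hanti, K, hK⟩, hrank⟩
    push Not at hrank
    obtain ⟨j, hj, hj0⟩ := hrank
    have hzero (i : ℕ) (hi : a 0 + m + 2 ≤ i) : a i = 0 := by
      have := hanti (show j ≤ i by omega)
      omega
    have hone : a 1 ≤ a 0 := hanti (by omega)
    refine ⟨⟨fun i j hij => ?_, K + a 0 + m + 1, fun T hT => ?_⟩, fun i hi => ?_⟩
    · have := hanti (show i + 1 ≤ j + 1 by omega)
      dsimp only
      split_ifs <;> omega
    · have hterm : ∀ i ∈ Finset.range T, (if i < a 0 + m + 1 then a (i + 1) + 1 else 0)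
          = a (i + 1) + if i < a 0 + m + 1 then 1 else 0 := by
        intro i _
        split_ifs with h
        · rfl
        · rw [hzero (i + 1) (by omega)]
      have hones : ∑ i ∈ Finset.range T, (if i < a 0 + m + 1 then 1 else 0) = a 0 + m + 1 :=
        sum_range_ite_lt (by omega)
      rw [Finset.sum_congr rfl hterm, Finset.sum_add_distrib, hones]
      have := hK (T + 1) (by omega)
      rw [Finset.sum_range_succ'] at this
      omega
    · have h0 : 0 < a 0 + m + 1 := by omega
      simp only [h0, if_true, zero_add] at hi
      have hi' : i < a 0 + m + 1 := by omega
      simp [hi']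
  · rintro a b ⟨⟨ha, -⟩, hra⟩ ⟨⟨hb, -⟩, hrb⟩ hab
    push Not at hra hrb
    obtain ⟨j, hj, hj0⟩ := hra
    obtain ⟨j', hj', hj0'⟩ := hrb
    have hval (i : ℕ) := congrFun hab i
    have h0 : a 0 = b 0 := by
      have h₁ := hval (a 0 + m + 1)
      have h₂ := hval (b 0 + m + 1)
      split_ifs at h₁ h₂ <;> omega
    funext i
    cases i with
    | zero => exact h0
    | succ i =>
      have := hval i
      by_cases h : i < a 0 + m + 1
      · rw [if_pos h, if_pos (by omega)] at this
        omega
      · have h₁ := ha (show j ≤ i + 1 by omega)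
        have h₂ := hb (show j' ≤ i + 1 by omega)
        omega
  · rintro b ⟨hb, hrank⟩
    obtain ⟨k, hk⟩ := exists_ne_zero_iff_lt hb
    obtain ⟨hanti, K, hK⟩ := hb
    have hb0 : b 0 ≠ 0 := by
      intro h
      have hzero (i : ℕ) : b i = 0 := by
        have := hanti (Nat.zero_le i)
        omega
      have := hK K le_rfl
      rw [Finset.sum_eq_zero fun i _ => hzero i] at this
      omega
    have hkb : b 0 + m ≤ k := by
      have := (hk (b 0 + m - 1)).mp (hrank _ (by omega))
      omega
    have hbz (i : ℕ) (hi : k ≤ i) : b i = 0 := by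
      by_contra h
      have := (hk i).mp h
      omega
    refine ⟨fun i => if i = 0 then k - (m + 1) else b (i - 1) - 1,
      ⟨⟨fun i j hij => ?_, K + k + 1, fun T hT => ?_⟩, ?_⟩, ?_⟩
    · have h₁ := hanti (show i - 1 ≤ j - 1 by omega)
      have h₂ := hanti (Nat.zero_le (j - 1))
      dsimp only
      split_ifs <;> omega
    · obtain ⟨T, rfl⟩ : ∃ t, T = t + 1 := ⟨T - 1, by omega⟩
      rw [Finset.sum_range_succ']
      simp only [Nat.add_one_ne_zero, if_false, if_true, Nat.add_sub_cancel]
      have hterm : ∀ i ∈ Finset.range T, b i = (b i - 1) + if i < k then 1 else 0 := by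
        intro i _
        have := hk i
        split_ifs with h
        · have := (hk i).mpr h
          omega
        · have := hbz i (by omega)
          omega
      have hones : ∑ i ∈ Finset.range T, (if i < k then 1 else 0) = k :=
        sum_range_ite_lt (by omega)
      have := hK T (by omega)
      rw [Finset.sum_congr rfl hterm, Finset.sum_add_distrib, hones] at this
      omega
    · push Not
      refine ⟨k + 1, by simp; omega, ?_⟩
      simp [hbz k le_rfl]
    · funext i
      dsimp only
      simp only [if_true, Nat.add_one_ne_zero, if_false, Nat.add_sub_cancel]
      split_ifs with h
      · have := (hk i).mpr (by omega)
        omega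
      · exact (hbz i (by omega)).symm

/-- Increase the first `m + 1` parts by one. -/
lemma ncard_lowRank_diff_le (m N : ℕ) :
    (lowRank (m + 1) N \ lowRank (m + 3) N).ncard ≤
      (lowRank m (N + m + 1) \ lowRank (m + 2) (N + m + 1)).ncard := by
  refine Set.ncard_le_ncard_of_injOn (fun a i => a i + if i < m + 1 then 1 else 0) ?_ ?_
    ((seqs_finite _).subset fun a ha => ha.1.1)
  · rintro a ⟨⟨⟨hanti, K, hK⟩, hrank⟩, hnot⟩
    refine ⟨⟨⟨fun i j hij => ?_, K + m + 1, fun T hT => ?_⟩, fun i hi => ?_⟩, fun h => ?_⟩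
    · have := hanti hij
      dsimp only
      split_ifs <;> omega
    · have hones : ∑ i ∈ Finset.range T, (if i < m + 1 then 1 else 0) = m + 1 :=
        sum_range_ite_lt (by omega)
      rw [Finset.sum_add_distrib, hones, hK T (by omega), add_assoc]
    · have hi' : i < a 0 + (m + 1) := by simp at hi; omega
      have := hrank i hi'
      dsimp only
      omega
    · refine hnot ⟨⟨hanti, K, hK⟩, fun i hi => ?_⟩
      have h₁ := h.2 i (by simp; omega)
      dsimp only at h₁
      split_ifs at h₁ with hlt
      · exact hrank i (by omega)
      · exact h₁
  · intro a _ b _ hab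
    funext i
    have := congrFun hab i
    dsimp only at this
    omega

lemma eq_of_antitone_of_add_eq {a : ℕ → ℕ} (ha : Antitone a) {m i j : ℕ}
    (hi : a i + m = i) (hj : a j + m = j) : i = j := by
  rcases lt_trichotomy i j with h | h | h
  · have := ha h.le
    omega
  · exact h
  · have := ha h.le
    omega

/-- Delete the part witnessing that `m + 1` is in the rank-set and increase all parts
before it by one. -/
lemma ncard_omitting_add (m N : ℕ) :
    (omitting m (N + m + 1)).ncard + (omitting (m + 1) N).ncard = (seqs N).ncard := by
  rw [← ncard_sep_add_ncard_sep_not N (fun a => ∀ i, a i + (m + 1) ≠ i), add_comm]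
  congr 1
  symm
  have hex (a : ℕ → ℕ) (ha : a ∈ {a ∈ seqs N | ¬ ∀ i, a i + (m + 1) ≠ i}) :
      ∃ i, a i + (m + 1) = i := by
    simpa using ha.2
  choose! w hw using hex
  refine Set.ncard_congr (fun a _ i => if i < w a then a i + 1 else a (i + 1)) ?_ ?_ ?_
  · intro a ha
    have hwa := hw a ha
    obtain ⟨⟨hanti, K, hK⟩, -⟩ := ha
    generalize w a = s at hwa
    refine ⟨⟨fun i j hij => ?_, K + s, fun T hT => ?_⟩, fun i => ?_⟩
    · have h₁ := hanti hij
      have h₂ := hanti (show i + 1 ≤ j + 1 by omega)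
      have h₃ := hanti (show i ≤ j + 1 by omega)
      dsimp only
      split_ifs <;> omega
    · have hsum : ∀ T, s ≤ T → ∑ i ∈ Finset.range T, (if i < s then a i + 1 else a (i + 1)) + a s
          = ∑ i ∈ Finset.range (T + 1), a i + s := by
        intro T hT
        induction T, hT using Nat.le_induction with
        | base =>
          rw [Finset.sum_congr rfl fun i hi => if_pos (Finset.mem_range.mp hi),
            Finset.sum_add_distrib, Finset.sum_range_succ]
          simp
          omega
        | succ T hT ih =>
          rw [Finset.sum_range_succ, Finset.sum_range_succ _ (T + 1), if_neg (by omega)]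
          omega
      have h₁ := hsum T (by omega)
      have h₂ := hK (T + 1) (by omega)
      dsimp only
      omega
    · dsimp only
      split_ifs with h
      · have := hanti h.le
        omega
      · have := hanti (show s ≤ i + 1 by omega)
        omega
  · intro a b ha hb hab
    have hwa := hw a ha
    have hwb := hw b hb
    have hamono := ha.1.1
    have hbmono := hb.1.1
    have hval (i : ℕ) := congrFun hab i
    generalize w a = s at *
    generalize w b = t at *
    have hst : s = t := by
      rcases lt_trichotomy s t with h | h | h
      · have h₁ := hval s
        rw [if_neg (by omega), if_pos h] at h₁
        have h₂ := hamono (show s ≤ s + 1 by omega)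
        have h₃ := hbmono h.le
        omega
      · exact h
      · have h₁ := hval t
        rw [if_pos h, if_neg (by omega)] at h₁
        have h₂ := hbmono (show t ≤ t + 1 by omega)
        have h₃ := hamono h.le
        omega
    subst hst
    funext i
    rcases lt_trichotomy i s with h | h | h
    · have := hval i
      rw [if_pos h, if_pos h] at this
      omega
    · subst h
      omega
    · obtain ⟨i, rfl⟩ : ∃ k, i = k + 1 := ⟨i - 1, by omega⟩
      have := hval i
      rwa [if_neg (by omega), if_neg (by omega)] at this
  · rintro b ⟨⟨hanti, K, hK⟩, homit⟩
    have hex : ∃ i, b i + m < i := by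
      refine ⟨b 0 + m + 1, ?_⟩
      have := hanti (Nat.zero_le (b 0 + m + 1))
      omega
    obtain ⟨s, hs, hmin⟩ : ∃ s, b s + m < s ∧ ∀ i, i < s → i < b i + m := by
      refine ⟨Nat.find hex, Nat.find_spec hex, fun i hi => ?_⟩
      have h₁ := Nat.find_min hex hi
      have h₂ := homit i
      omega
    have hbefore (i : ℕ) (hi : i < s) : s ≤ b i + m := by
      have h₁ := hmin (s - 1) (by omega)
      have h₂ := hanti (show i ≤ s - 1 by omega)
      omega
    set a : ℕ → ℕ := fun i => if i < s then b i - 1 else if i = s then s - (m + 1) else b (i - 1)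
      with hadef
    have hanti' : Antitone a := by
      intro i j hij
      have h₁ := hanti hij
      have h₂ := hanti (show i - 1 ≤ j - 1 by omega)
      have h₃ := hbefore i
      have h₄ : s ≤ j - 1 → b (j - 1) ≤ b s := fun h => hanti h
      simp only [hadef]
      split_ifs <;> grind
    have has : a s + (m + 1) = s := by
      simp only [hadef, lt_irrefl, if_false, if_true]
      omega
    have ha : a ∈ {a ∈ seqs N | ¬ ∀ i, a i + (m + 1) ≠ i} := by
      refine ⟨⟨hanti', K + s + 1, fun T hT => ?_⟩, fun h => h s has⟩
      obtain ⟨T, rfl⟩ : ∃ t, T = t + 1 := ⟨T - 1, by omega⟩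
      have hsum : ∀ T, s ≤ T →
          ∑ i ∈ Finset.range (T + 1), a i + (m + 1) = ∑ i ∈ Finset.range T, b i := by
        intro T hT
        induction T, hT using Nat.le_induction with
        | base =>
          have hterm : ∀ i ∈ Finset.range s, b i = a i + 1 := by
            intro i hi
            have hi := Finset.mem_range.mp hi
            have h₁ := hbefore i hi
            simp only [hadef, if_pos hi]
            omega
          rw [Finset.sum_congr rfl hterm, Finset.sum_add_distrib, Finset.sum_range_succ]
          simp
          omega
        | succ T hT ih =>
          rw [Finset.sum_range_succ, Finset.sum_range_succ b T, ← ih]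
          have : a (T + 1) = b T := by
            simp only [hadef]
            rw [if_neg (by omega), if_neg (by omega), Nat.add_sub_cancel]
          omega
      have h₁ := hsum T (by omega)
      have h₂ := hK T (by omega)
      omega
    have hws : w a = s := eq_of_antitone_of_add_eq hanti' (hw a ha) has
    refine ⟨a, ha, ?_⟩
    funext i
    rw [hws]
    split_ifs with h
    · have := hbefore i h
      simp only [hadef, if_pos h]
      omega
    · simp only [hadef]
      rw [if_neg (by omega), if_neg (by omega), Nat.add_sub_cancel]

lemma sum_range_le_of_mem_seqs {n : ℕ} {a : ℕ → ℕ} (ha : a ∈ seqs n) (k : ℕ) :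
    ∑ i ∈ Finset.range k, a i ≤ n := by
  obtain ⟨-, K, hK⟩ := ha
  rw [← hK (K + k) (by omega)]
  exact Finset.sum_le_sum_of_subset (Finset.range_mono (by omega))

lemma index_lt_of_ne_zero {n : ℕ} {a : ℕ → ℕ} (ha : a ∈ seqs n) {i : ℕ} (hi : a i ≠ 0) : i < n := by
  refine lt_of_lt_of_le (Nat.lt_succ_self i) (le_trans ?_ (sum_range_le_of_mem_seqs ha (i + 1)))
  have : ∑ j ∈ Finset.range (i + 1), 1 ≤ ∑ j ∈ Finset.range (i + 1), a j := by
    refine Finset.sum_le_sum fun j hj => ?_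
    have := ha.1 (Nat.lt_succ_iff.mp (Finset.mem_range.mp hj))
    omega
  simpa using this

lemma lowRank_eq_empty {m n : ℕ} (h : n < m) : lowRank m n = ∅ := by
  refine Set.eq_empty_of_forall_notMem fun a ha => ?_
  have := index_lt_of_ne_zero ha.1 (ha.2 (m - 1) (by omega))
  omega

lemma omitting_eq_empty {m n : ℕ} (h : n ≤ m) : omitting m n = ∅ := by
  refine Set.eq_empty_of_forall_notMem fun a ha => ha.2 m ?_
  have : a m = 0 := by
    by_contra hm
    have := index_lt_of_ne_zero ha.1 hm
    omega
  omega

lemma lowRank_anti {m m' : ℕ} (h : m ≤ m') (n : ℕ) : lowRank m' n ⊆ lowRank m n :=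
  fun _ ha => ⟨ha.1, fun i hi => ha.2 i (by omega)⟩

lemma ncard_lowRank_diff_add {m m' : ℕ} (h : m ≤ m') (n : ℕ) :
    (lowRank m n \ lowRank m' n).ncard + (lowRank m' n).ncard = (lowRank m n).ncard :=
  Set.ncard_sdiff_add_ncard_of_subset (lowRank_anti h n)
    ((seqs_finite n).subset fun _ ha => ha.1)

theorem ncard_omitting_bounds (n : ℕ) : ∀ m,
    (lowRank (m + 2) n).ncard ≤ (omitting m n).ncard ∧
      (omitting m n).ncard ≤ (lowRank m n).ncard := by
  induction n using Nat.strong_induction_on with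
  | _ n ih =>
    intro m
    rcases le_or_gt n m with hnm | hmn
    · rw [lowRank_eq_empty (by omega : n < m + 2), omitting_eq_empty hnm]
      simp
    · obtain ⟨N, rfl⟩ : ∃ N, n = N + m + 1 := ⟨n - (m + 1), by omega⟩
      obtain ⟨h₁, h₂⟩ := ih N (by omega) (m + 1)
      have h₃ := ncard_lowRank_add m N
      have h₄ := ncard_omitting_add m N
      have h₅ := ncard_lowRank_diff_le m N
      have h₆ := ncard_lowRank_diff_add (show m + 1 ≤ m + 3 by omega) N
      have h₇ := ncard_lowRank_diff_add (show m ≤ m + 2 by omega) (N + m + 1)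
      rw [show m + 1 + 2 = m + 3 by omega] at h₁
      omega

end RankCrank

open RankCrank in
/-- For every integer `m ≥ 0` and every `n ≥ 1`, `q(m, n) ≥ p(-m+1, n)`. -/
theorem prank_le_q (m : ℤ) (hm : 0 ≤ m) (n : ℕ) (hn : 1 ≤ n) :
    prank (-m + 1) n ≤ q m n := by
  lift m to ℕ using hm
  have h₁ := prank_add_ncard_lowRank m n
  have h₂ := q_add_ncard_omitting m n
  have h₃ := (ncard_omitting_bounds n m).2
  omega
end

section
/- Let m ≥ 0 and n ≥ 1, let λ be a partition of n, and let j = j_m(λ). Then m appears in the rank-set of λ if and only if either j = 0, or j ≥ 1 and λ_{m+j+1} = j. -/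
open scoped BigOperators

namespace RankCrank

theorem antitone_part {n : ℕ} (l : n.Partition) : Antitone (part l) := by
  intro a b hab
  have hs : ((l.parts.sort (· ≤ ·)).reverse).Pairwise (· ≥ ·) :=
    List.pairwise_reverse.2 (Multiset.pairwise_sort l.parts (· ≤ ·))
  unfold part
  generalize (l.parts.sort (· ≤ ·)).reverse = L at hs
  rcases lt_or_ge (b - 1) L.length with hb | hb
  · have ha : a - 1 < L.length := by omega
    rw [List.getD_eq_getElem _ _ ha, List.getD_eq_getElem _ _ hb]
    rcases (Nat.sub_le_sub_right hab 1).eq_or_lt with h | h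
    · simp [h]
    · exact List.pairwise_iff_getElem.1 hs _ _ ha hb h
  · rw [List.getD_eq_default _ _ hb]
    exact Nat.zero_le _

theorem le_jm_iff {n : ℕ} (m : ℕ) (l : n.Partition) (j : ℕ) :
    j ≤ jm m l ↔ j ≤ part l (m + j) := by
  have hbdd : BddAbove {j : ℕ | j ≤ part l (m + j)} :=
    ⟨part l 0, fun _ hi => le_trans hi (antitone_part l (Nat.zero_le _))⟩
  have hmem : jm m l ≤ part l (m + jm m l) :=
    Nat.sSup_mem (s := {j : ℕ | j ≤ part l (m + j)}) ⟨0, Nat.zero_le _⟩ hbdd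
  refine ⟨fun h => ?_, fun h => le_csSup hbdd h⟩
  exact h.trans (hmem.trans (antitone_part l (by omega)))

theorem jm_eq_of_part_eq {n : ℕ} {m : ℕ} {l : n.Partition} {j : ℕ}
    (h : part l (m + j + 1) = j) : jm m l = j := by
  have h₁ := (le_jm_iff m l j).2 (h.ge.trans (antitone_part l (Nat.le_succ (m + j))))
  have h₂ : ¬ j + 1 ≤ jm m l := by
    rw [le_jm_iff, ← add_assoc, h]
    omega
  omega

end RankCrank

open RankCrank in
/-- For `m ≥ 0`, `n ≥ 1`, a partition `λ` of `n` and `j = j_m(λ)`: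
`m` appears in the rank-set of `λ` iff `j = 0`, or `j ≥ 1` and `λ_{m+j+1} = j`. -/
theorem mem_rankSet_iff (m n : ℕ) (hn : 1 ≤ n) (l : n.Partition) :
    (m : ℤ) ∈ rankSet l ↔
      (jm m l = 0 ∨ (1 ≤ jm m l ∧ part l (m + jm m l + 1) = jm m l)) := by
  constructor
  · rintro ⟨k, hk⟩
    obtain ⟨i, rfl⟩ : ∃ i, k = m + i := ⟨k - m, by omega⟩
    have hi : part l (m + i + 1) = i := by omega
    rw [jm_eq_of_part_eq hi, hi]
    omega
  · intro h
    have hpart : part l (m + jm m l + 1) = jm m l := by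
      rcases h with h | h
      · have h₁ := (le_jm_iff m l 1).not.1 (by omega)
        rw [h, add_zero]
        omega
      · exact h.2
    exact ⟨m + jm m l, by rw [hpart]; push_cast; ring⟩
end

section
/- For every integer n ≥ 1, spt(n) is at most the sum of |crank(λ)| over all partitions λ of n. -/
open scoped BigOperators

namespace PartitionMultiset

open Finset

/-- The multisets of parts of the partitions of `n`. -/
def partitions (n : ℕ) : Finset (Multiset ℕ) :=
  (Finset.univ : Finset n.Partition).image Nat.Partition.parts

lemma mem_partitions {n : ℕ} {s : Multiset ℕ} :
    s ∈ partitions n ↔ (∀ x ∈ s, 0 < x) ∧ s.sum = n := by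
  simp only [partitions, mem_image, mem_univ, true_and]
  constructor
  · rintro ⟨l, rfl⟩
    exact ⟨fun x hx => l.parts_pos hx, l.parts_sum⟩
  · rintro ⟨h, rfl⟩
    exact ⟨⟨s, fun hx => h _ hx, rfl⟩, rfl⟩

lemma sum_partition {M : Type*} [AddCommMonoid M] (n : ℕ) (f : Multiset ℕ → M) :
    ∑ l : n.Partition, f l.parts = ∑ s ∈ partitions n, f s := by
  rw [partitions, sum_image]
  intro a _ b _ h
  exact Nat.Partition.ext h

/-- The number of elements of `s` that are at least `b`. -/
def countGE (s : Multiset ℕ) (b : ℕ) : ℕ := s.countP (b ≤ ·)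

lemma countGE_eq_count_add (s : Multiset ℕ) (b : ℕ) :
    countGE s b = s.count b + countGE s (b + 1) := by
  unfold countGE
  induction s using Multiset.induction_on with
  | empty => simp
  | cons a s ih =>
    simp only [Multiset.countP_cons, Multiset.count_cons, ih]
    split_ifs <;> omega

lemma countGE_anti (s : Multiset ℕ) {b c : ℕ} (h : b ≤ c) : countGE s c ≤ countGE s b := by
  unfold countGE
  induction s using Multiset.induction_on with
  | empty => simp
  | cons a s ih =>
    simp only [Multiset.countP_cons]
    split_ifs <;> omega

lemma countGE_mul_le_sum (s : Multiset ℕ) (b : ℕ) : countGE s b * b ≤ s.sum := by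
  unfold countGE
  induction s using Multiset.induction_on with
  | empty => simp
  | cons a s ih =>
    simp only [Multiset.countP_cons, Multiset.sum_cons]
    split_ifs <;> nlinarith

lemma countGE_eq_zero {s : Multiset ℕ} {b : ℕ} (h : s.sum < b) : countGE s b = 0 := by
  by_contra h0
  have := countGE_mul_le_sum s b
  have : 1 * b ≤ countGE s b * b := Nat.mul_le_mul_right _ (Nat.one_le_iff_ne_zero.2 h0)
  omega

lemma countGE_one {s : Multiset ℕ} (h : ∀ x ∈ s, 0 < x) : countGE s 1 = s.card :=
  Multiset.countP_eq_card.2 h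

lemma card_le_sum {s : Multiset ℕ} (h : ∀ x ∈ s, 0 < x) : s.card ≤ s.sum := by
  have := countGE_mul_le_sum s 1
  rw [countGE_one h] at this
  omega

lemma eq_of_countGE_eq {s t : Multiset ℕ} (hs : ∀ x ∈ s, 0 < x) (ht : ∀ x ∈ t, 0 < x)
    (h : ∀ b, 1 ≤ b → countGE s b = countGE t b) : s = t := by
  ext b
  rcases Nat.eq_zero_or_pos b with rfl | hb
  · rw [Multiset.count_eq_zero_of_notMem fun h0 => (hs 0 h0).false,
      Multiset.count_eq_zero_of_notMem fun h0 => (ht 0 h0).false]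
  · have h1 := countGE_eq_count_add s b
    have h2 := countGE_eq_count_add t b
    have h3 := h b hb
    have h4 := h (b + 1) (by omega)
    omega

lemma sum_countGE (s : Multiset ℕ) {K : ℕ} (h : ∀ x ∈ s, x ≤ K) :
    ∑ b ∈ Icc 1 K, countGE s b = s.sum := by
  unfold countGE
  induction s using Multiset.induction_on with
  | empty => simp
  | cons a s ih =>
    simp only [Multiset.countP_cons, Multiset.sum_cons, sum_add_distrib]
    rw [ih fun x hx => h x (Multiset.mem_cons_of_mem hx), add_comm, ← card_filter]
    congr 1
    have ha := h a (Multiset.mem_cons_self _ _)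
    have : (Icc 1 K).filter (· ≤ a) = Icc 1 a := by
      ext b
      simp only [mem_filter, mem_Icc]
      omega
    rw [this]
    simp

lemma countGE_eq_sum_count (s : Multiset ℕ) {k K : ℕ} (h : ∀ x ∈ s, x ≤ K) :
    countGE s k = ∑ j ∈ Icc k K, s.count j := by
  unfold countGE
  induction s using Multiset.induction_on with
  | empty => simp
  | cons a s ih =>
    simp only [Multiset.countP_cons, Multiset.count_cons, sum_add_distrib]
    rw [ih fun x hx => h x (Multiset.mem_cons_of_mem hx)]
    have ha := h a (Multiset.mem_cons_self _ _)
    simp [ha]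

/-- The multiset of parts of the conjugate partition. -/
def conj (s : Multiset ℕ) : Multiset ℕ :=
  ((Icc 1 s.sum).val.map (countGE s)).filter (0 < ·)

lemma conj_pos (s : Multiset ℕ) : ∀ x ∈ conj s, 0 < x := fun _ hx =>
  (Multiset.mem_filter.1 hx).2

lemma sum_filter_pos (s : Multiset ℕ) : (s.filter (0 < ·)).sum = s.sum := by
  induction s using Multiset.induction_on with
  | empty => simp
  | cons a s ih =>
    rcases Nat.eq_zero_or_pos a with rfl | ha
    · simpa using ih
    · simp [ha, ih]

lemma countGE_filter_pos (s : Multiset ℕ) {b : ℕ} (hb : 1 ≤ b) :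
    countGE (s.filter (0 < ·)) b = countGE s b := by
  unfold countGE
  rw [Multiset.countP_filter]
  exact Multiset.countP_congr rfl fun x _ => by
    simp only [eq_iff_iff]
    omega

lemma sum_conj {s : Multiset ℕ} : (conj s).sum = s.sum := by
  rw [conj, sum_filter_pos]
  exact sum_countGE s fun x hx => Multiset.le_sum_of_mem hx

lemma conj_mem {n : ℕ} {s : Multiset ℕ} (h : s ∈ partitions n) : conj s ∈ partitions n :=
  mem_partitions.2 ⟨conj_pos s, sum_conj.trans (mem_partitions.1 h).2⟩

lemma le_countGE_conj (s : Multiset ℕ) {a b : ℕ} (ha : 1 ≤ a) (hb : 1 ≤ b) :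
    b ≤ countGE (conj s) a ↔ a ≤ countGE s b := by
  have key : countGE (conj s) a = ((Icc 1 s.sum).filter (a ≤ countGE s ·)).card := by
    rw [conj, countGE_filter_pos _ ha, countGE, Multiset.countP_map]
    rfl
  rw [key]
  constructor
  · intro h
    by_contra! hlt
    have hsub : (Icc 1 s.sum).filter (a ≤ countGE s ·) ⊆ Icc 1 (b - 1) := by
      intro c hc
      simp only [mem_filter, mem_Icc] at hc ⊢
      refine ⟨hc.1.1, ?_⟩
      by_contra hcb
      have := countGE_anti s (show b ≤ c by omega)
      omega
    have := card_le_card hsub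
    simp only [Nat.card_Icc] at this
    omega
  · intro h
    have hsub : Icc 1 b ⊆ (Icc 1 s.sum).filter (a ≤ countGE s ·) := by
      intro c hc
      simp only [mem_filter, mem_Icc] at hc ⊢
      have h1 := countGE_anti s hc.2
      refine ⟨⟨hc.1, ?_⟩, h.trans h1⟩
      by_contra hcs
      have := countGE_eq_zero (s := s) (b := c) (by omega)
      omega
    have := card_le_card hsub
    simpa using this

lemma conj_conj {s : Multiset ℕ} (hs : ∀ x ∈ s, 0 < x) : conj (conj s) = s := by
  refine eq_of_countGE_eq (conj_pos _) hs fun b hb => eq_of_forall_le_iff fun c => ?_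
  rcases Nat.eq_zero_or_pos c with rfl | hc
  · simp
  · rw [le_countGE_conj _ hb hc, le_countGE_conj _ hc hb]

lemma sum_comp_conj {M : Type*} [AddCommMonoid M] (n : ℕ) (f : Multiset ℕ → M) :
    ∑ s ∈ partitions n, f (conj s) = ∑ s ∈ partitions n, f s :=
  sum_nbij' conj conj (fun _ h => conj_mem h) (fun _ h => conj_mem h)
    (fun _ h => conj_conj (mem_partitions.1 h).1) (fun _ h => conj_conj (mem_partitions.1 h).1)
    (fun _ _ => rfl)

lemma sum_sub {M : Type*} [AddCommMonoid M] (n : ℕ) {r : Multiset ℕ} (hr : ∀ x ∈ r, 0 < x)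
    (f : Multiset ℕ → M) :
    ∑ s ∈ partitions n with r ≤ s, f (s - r) =
      if r.sum ≤ n then ∑ s ∈ partitions (n - r.sum), f s else 0 := by
  split_ifs with h
  · refine sum_nbij' (· - r) (· + r) ?_ ?_ ?_ ?_ ?_
    · intro s hs
      simp only [mem_filter, mem_partitions] at hs ⊢
      refine ⟨fun x hx => hs.1.1 x (Multiset.mem_of_le (Multiset.sub_le_self _ _) hx), ?_⟩
      have := congrArg Multiset.sum (tsub_add_cancel_of_le hs.2)
      rw [Multiset.sum_add] at this
      omega
    · intro s hs
      simp only [mem_filter, mem_partitions] at hs ⊢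
      refine ⟨⟨fun x hx => ?_, ?_⟩, Multiset.le_add_left _ _⟩
      · rcases Multiset.mem_add.1 hx with hx | hx
        · exact hs.1 x hx
        · exact hr x hx
      · rw [Multiset.sum_add]
        omega
    · intro s hs
      exact tsub_add_cancel_of_le (mem_filter.1 hs).2
    · intro s _
      exact Multiset.add_sub_cancel_right
    · simp
  · refine sum_eq_zero fun s hs => absurd ?_ h
    simp only [mem_filter, mem_partitions] at hs
    have := congrArg Multiset.sum (tsub_add_cancel_of_le hs.2)
    rw [Multiset.sum_add] at this
    omega

/-- Removing `r` from the parts and inserting `r'` instead, for `r.sum = r'.sum`. -/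
lemma sum_sub_eq_sum_sub {M : Type*} [AddCommMonoid M] (n : ℕ) {r r' : Multiset ℕ}
    (hr : ∀ x ∈ r, 0 < x) (hr' : ∀ x ∈ r', 0 < x) (h : r.sum = r'.sum) (f : Multiset ℕ → M) :
    ∑ s ∈ partitions n with r ≤ s, f (s - r) = ∑ s ∈ partitions n with r' ≤ s, f (s - r') := by
  rw [sum_sub n hr, sum_sub n hr', h]

lemma sum_sub_eq_sum_conj_sub {M : Type*} [AddCommMonoid M] (n : ℕ) {r r' : Multiset ℕ}
    (hr : ∀ x ∈ r, 0 < x) (hr' : ∀ x ∈ r', 0 < x) (h : r.sum = r'.sum) (f : Multiset ℕ → M) :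
    ∑ s ∈ partitions n with r ≤ s, f (s - r) =
      ∑ s ∈ partitions n with r' ≤ s, f (conj (s - r')) := by
  rw [sum_sub n hr, sum_sub n hr' (fun s => f (conj s)), h, sum_comp_conj]

lemma countGE_sub_add {r s : Multiset ℕ} (h : r ≤ s) (b : ℕ) :
    countGE (s - r) b + countGE r b = countGE s b := by
  rw [countGE, countGE, ← Multiset.countP_add, tsub_add_cancel_of_le h, countGE]

lemma countGE_replicate_one (k : ℕ) {b : ℕ} (hb : 2 ≤ b) :
    countGE (Multiset.replicate k 1) b = 0 :=
  Multiset.countP_eq_zero.2 fun x hx => by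
    rw [Multiset.eq_of_mem_replicate hx]
    omega

lemma countGE_singleton (k a : ℕ) : countGE {k} a = if a ≤ k then 1 else 0 := by
  rw [countGE, ← Multiset.cons_zero, Multiset.countP_cons, Multiset.countP_zero, zero_add]

lemma pos_of_mem_replicate_one {k : ℕ} : ∀ x ∈ Multiset.replicate k 1, 0 < x := fun x hx => by
  rw [Multiset.eq_of_mem_replicate hx]
  exact one_pos

lemma card_le_countGE_eq (n : ℕ) {a b : ℕ} (ha : 1 ≤ a) (hb : 1 ≤ b) :
    #{s ∈ partitions n | a ≤ countGE s b} = #{s ∈ partitions n | b ≤ countGE s a} := by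
  rw [card_filter, card_filter, ← sum_comp_conj]
  exact sum_congr rfl fun s _ => by simp only [le_countGE_conj s hb ha]

lemma card_le_count_one_le_countGE_eq (n : ℕ) {k a b : ℕ} (hk : 1 ≤ k) (ha : 1 ≤ a)
    (hb : 2 ≤ b) :
    #{s ∈ partitions n | k ≤ s.count 1 ∧ a ≤ countGE s b} =
      #{s ∈ partitions n | k ∈ s ∧ b + (if a ≤ k then 1 else 0) ≤ countGE s a} := by
  have key := sum_sub_eq_sum_conj_sub n (r := Multiset.replicate k 1) (r' := {k})
    pos_of_mem_replicate_one (by simpa using Nat.pos_of_ne_zero (by omega)) (by simp)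
    (fun u => if a ≤ countGE u b then 1 else 0)
  rw [← card_filter, ← card_filter, filter_filter, filter_filter] at key
  convert key using 2
  · refine filter_congr fun s _ => ?_
    rw [Multiset.le_count_iff_replicate_le]
    refine and_congr_right fun h => ?_
    have := countGE_sub_add h b
    rw [countGE_replicate_one k hb] at this
    rw [← this, add_zero]
  · refine filter_congr fun s _ => ?_
    rw [Multiset.singleton_le]
    refine and_congr_right fun h => ?_
    rw [le_countGE_conj _ (by omega) ha, ← countGE_sub_add (Multiset.singleton_le.2 h) a,
      countGE_singleton]
    exact Nat.add_le_add_iff_right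

open scoped Classical in
lemma sum_ite_countGE_le (s : Multiset ℕ) {K m : ℕ} (hK : s.sum ≤ K) :
    (∑ k ∈ range (K + 1), if (k = 0 ∨ k ∈ s) ∧ m + k + 1 ≤ countGE s (k + 1) then 1 else 0) ≤
      (∑ k ∈ range (K + 1), if k + 1 ∈ s ∧ m + k + 2 ≤ countGE s (k + 1) then 1 else 0) +
        if ∃ j, 1 ≤ j ∧ countGE s j = j + m then 1 else 0 := by
  rw [sum_range_succ (fun k => if k + 1 ∈ s ∧ m + k + 2 ≤ countGE s (k + 1) then 1 else 0)]
  by_cases hj : ∃ j, 1 ≤ j ∧ countGE s j = j + m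
  · rw [sum_range_succ', if_pos hj]
    refine add_le_add (le_add_right (sum_le_sum fun k _ => ?_)) (by split_ifs <;> simp)
    have := countGE_anti s (show k + 1 ≤ k + 1 + 1 by omega)
    by_cases hks : k + 1 ∈ s
    · simp only [hks, or_true, true_and]
      split_ifs <;> omega
    · simp [hks]
  · have key : ∀ L, (∑ k ∈ range (L + 1),
        if (k = 0 ∨ k ∈ s) ∧ m + k + 1 ≤ countGE s (k + 1) then 1 else 0) ≤
      (∑ k ∈ range L, if k + 1 ∈ s ∧ m + k + 2 ≤ countGE s (k + 1) then 1 else 0) +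
        if m + L + 1 ≤ countGE s (L + 1) then 1 else 0 := by
      intro L
      induction L with
      | zero =>
        simp only [zero_add, sum_range_one, true_or, true_and, sum_range_zero]
        exact le_rfl
      | succ L ih =>
        rw [sum_range_succ, sum_range_succ (fun k => if k + 1 ∈ s ∧ _ then 1 else 0)]
        have h1 := countGE_eq_count_add s (L + 1)
        have h2 : countGE s (L + 1) ≠ L + 1 + m := fun h => hj ⟨L + 1, by omega, h⟩
        by_cases hL : L + 1 ∈ s
        · simp only [hL, or_true, true_and]
          split_ifs at ih ⊢ <;> omega
        · rw [Multiset.count_eq_zero_of_notMem hL] at h1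
          simp only [hL, or_false, false_and, if_false, Nat.succ_ne_zero]
          split_ifs at ih ⊢ <;> omega
    have h0 := key K
    rw [if_neg (show ¬ m + K + 1 ≤ countGE s (K + 1) by
      rw [countGE_eq_zero (by omega)]
      omega)] at h0
    rw [if_neg hj]
    omega

open scoped Classical in
lemma card_countGE_gt_count_one_le (n : ℕ) {m : ℕ} (hm : 1 ≤ m) :
    #{s ∈ partitions n | s.count 1 + 1 ≤ countGE s (m + s.count 1 + 1)} ≤
      #{s ∈ partitions n | ∃ j, 1 ≤ j ∧ countGE s j = j + m} := by
  have hX : ∀ k, #{s ∈ partitions n | k ≤ s.count 1 ∧ k + 1 ≤ countGE s (m + k + 1)} =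
      #{s ∈ partitions n | (k = 0 ∨ k ∈ s) ∧ m + k + 1 ≤ countGE s (k + 1)} := by
    intro k
    rcases Nat.eq_zero_or_pos k with rfl | hk
    · simpa using card_le_countGE_eq n le_rfl (by omega : 1 ≤ m + 0 + 1)
    · rw [card_le_count_one_le_countGE_eq n hk (by omega) (by omega)]
      simp [hk.ne']
  have hY : ∀ k, #{s ∈ partitions n | k + 1 ≤ s.count 1 ∧ k + 1 ≤ countGE s (m + k + 1)} =
      #{s ∈ partitions n | k + 1 ∈ s ∧ m + k + 2 ≤ countGE s (k + 1)} := by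
    intro k
    rw [card_le_count_one_le_countGE_eq n (by omega) (by omega) (by omega)]
    simp only [le_refl, if_true]
  have hZ : ∀ k, #{s ∈ partitions n | k ≤ s.count 1 ∧ k + 1 ≤ countGE s (m + k + 1)} =
      #{s ∈ partitions n | k + 1 ≤ s.count 1 ∧ k + 1 ≤ countGE s (m + k + 1)} +
      #{s ∈ partitions n | s.count 1 = k ∧ k + 1 ≤ countGE s (m + k + 1)} := by
    intro k
    rw [← card_union_of_disjoint, ← filter_or]
    · congr 1
      refine filter_congr fun s _ => ?_
      omega
    · refine disjoint_filter.2 fun s _ h h' => ?_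
      omega
  have hsum : #{s ∈ partitions n | s.count 1 + 1 ≤ countGE s (m + s.count 1 + 1)} =
      ∑ k ∈ range (n + 1),
        #{s ∈ partitions n | s.count 1 = k ∧ k + 1 ≤ countGE s (m + k + 1)} := by
    simp only [card_filter]
    rw [sum_comm]
    refine sum_congr rfl fun s hs => ?_
    rw [mem_partitions] at hs
    rw [sum_eq_single (s.count 1)]
    · simp
    · intro k _ hk
      rw [if_neg fun h => hk h.1.symm]
    · intro h
      refine absurd (mem_range.2 ?_) h
      have := card_le_sum hs.1
      have := s.count_le_card 1
      omega
  have hle : ∑ k ∈ range (n + 1),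
        #{s ∈ partitions n | (k = 0 ∨ k ∈ s) ∧ m + k + 1 ≤ countGE s (k + 1)} ≤
      ∑ k ∈ range (n + 1), #{s ∈ partitions n | k + 1 ∈ s ∧ m + k + 2 ≤ countGE s (k + 1)} +
      #{s ∈ partitions n | ∃ j, 1 ≤ j ∧ countGE s j = j + m} := by
    simp only [card_filter]
    rw [sum_comm, sum_comm (s := range (n + 1)), ← sum_add_distrib]
    exact sum_le_sum fun s hs => sum_ite_countGE_le s (mem_partitions.1 hs).2.le
  rw [← sum_congr rfl fun k _ => hX k, sum_congr rfl fun k _ => hZ k, sum_add_distrib, ← hsum,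
    sum_congr rfl fun k _ => hY k] at hle
  omega

/-- Decrease by one all parts that are at least `j`, and insert the part `j - 1`. -/
def lower (j : ℕ) (s : Multiset ℕ) : Multiset ℕ :=
  ((j - 1) ::ₘ s.map fun x => if j ≤ x then x - 1 else x).filter (0 < ·)

lemma lower_pos (j : ℕ) (s : Multiset ℕ) : ∀ x ∈ lower j s, 0 < x := fun _ hx =>
  (Multiset.mem_filter.1 hx).2

lemma sum_lower_add {j : ℕ} (hj : 1 ≤ j) (s : Multiset ℕ) :
    (lower j s).sum + countGE s j = s.sum + (j - 1) := by
  rw [lower, sum_filter_pos, Multiset.sum_cons, countGE]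
  induction s using Multiset.induction_on with
  | empty => simp
  | cons a s ih =>
    simp only [Multiset.map_cons, Multiset.sum_cons, Multiset.countP_cons]
    split_ifs <;> omega

lemma countGE_lower {j : ℕ} (s : Multiset ℕ) {b : ℕ} (hb : 1 ≤ b) :
    countGE (lower j s) b = if b < j then countGE s b + 1 else countGE s (b + 1) := by
  rw [lower, countGE_filter_pos _ hb]
  unfold countGE
  rw [Multiset.countP_cons]
  induction s using Multiset.induction_on with
  | empty =>
    simp only [Multiset.map_zero, Multiset.countP_zero]
    split_ifs <;> omega
  | cons a s ih =>
    simp only [Multiset.map_cons, Multiset.countP_cons]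
    split_ifs at ih ⊢ <;> omega

lemma lower_index_le {m j k : ℕ} {s t : Multiset ℕ} (hj : 1 ≤ j)
    (hs : countGE s j = j + m) (ht : countGE t k = k + m) (h : lower j s = lower k t) :
    k ≤ j := by
  by_contra! hlt
  have h1 := countGE_lower (j := j) s hj
  have h2 := countGE_lower (j := k) t hj
  rw [h, if_neg (lt_irrefl j)] at h1
  rw [if_pos hlt] at h2
  have := countGE_anti s (show j ≤ j + 1 by omega)
  have := countGE_anti t hlt.le
  omega

lemma lower_injective {m j k : ℕ} {s t : Multiset ℕ} (hj : 1 ≤ j) (hk : 1 ≤ k)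
    (hs : countGE s j = j + m) (ht : countGE t k = k + m)
    (hs' : ∀ x ∈ s, 0 < x) (ht' : ∀ x ∈ t, 0 < x) (h : lower j s = lower k t) : s = t := by
  obtain rfl : j = k := (lower_index_le hk ht hs h.symm).antisymm (lower_index_le hj hs ht h)
  refine eq_of_countGE_eq hs' ht' fun b hb => ?_
  rcases lt_trichotomy b j with hbj | rfl | hbj
  · have h1 := countGE_lower (j := j) s hb
    have h2 := countGE_lower (j := j) t hb
    rw [if_pos hbj] at h1 h2
    rw [h] at h1
    omega
  · omega
  · have h1 := countGE_lower (j := j) s (b := b - 1) (by omega)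
    have h2 := countGE_lower (j := j) t (b := b - 1) (by omega)
    rw [if_neg (by omega), Nat.sub_add_cancel hb] at h1 h2
    rw [← h1, ← h2, h]

open scoped Classical in
lemma card_exists_countGE_eq_le (n m : ℕ) :
    #{s ∈ partitions n | ∃ j, 1 ≤ j ∧ countGE s j = j + m} ≤
      #{s ∈ partitions n | m + 1 ≤ s.count 1} := by
  have : ∀ s : Multiset ℕ, ∃ j, (∃ j, 1 ≤ j ∧ countGE s j = j + m) →
      1 ≤ j ∧ countGE s j = j + m := by
    intro s
    by_cases h : ∃ j, 1 ≤ j ∧ countGE s j = j + m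
    · exact ⟨h.choose, fun _ => h.choose_spec⟩
    · exact ⟨0, fun h' => absurd h' h⟩
  choose J hJ using this
  refine card_le_card_of_injOn (fun s => lower (J s) s + Multiset.replicate (m + 1) 1) ?_ ?_
  · intro s hs
    rw [mem_coe, mem_filter, mem_partitions] at hs
    obtain ⟨h1, h2⟩ := hJ s hs.2
    have h3 := sum_lower_add h1 s
    rw [mem_coe, mem_filter, mem_partitions]
    refine ⟨⟨fun x hx => ?_, ?_⟩, by simp⟩
    · rcases Multiset.mem_add.1 hx with hx | hx
      · exact lower_pos _ _ x hx
      · exact pos_of_mem_replicate_one x hx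
    · simp only [Multiset.sum_add, Multiset.sum_replicate, smul_eq_mul, mul_one]
      have := hs.1.2
      omega
  · intro s hs t ht h
    rw [mem_coe, mem_filter, mem_partitions] at hs ht
    exact lower_injective (hJ s hs.2).1 (hJ t ht.2).1 (hJ s hs.2).2 (hJ t ht.2).2 hs.1.1 ht.1.1
      (add_right_cancel h)

lemma card_le_count_one_sub {n m : ℕ} (h : m ≤ n) (P : Multiset ℕ → Prop) [DecidablePred P] :
    #{s ∈ partitions n | m ≤ s.count 1 ∧ P (s - Multiset.replicate m 1)} =
      #{s ∈ partitions (n - m) | P s} := by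
  have key := sum_sub n (r := Multiset.replicate m 1) pos_of_mem_replicate_one
    (fun u => if P u then 1 else 0)
  rw [← card_filter, filter_filter] at key
  simp only [Multiset.sum_replicate, smul_eq_mul, mul_one, if_pos h, ← card_filter] at key
  simpa only [Multiset.le_count_iff_replicate_le] using key

lemma card_le_count_one_le (n : ℕ) {m : ℕ} (hm : 1 ≤ m) :
    #{s ∈ partitions n | m ≤ s.count 1} ≤
      #{s ∈ partitions n | m + countGE s (s.count 1 + 1) ≤ s.count 1} +
        #{s ∈ partitions n | 2 * m + 1 ≤ s.count 1} := by
  classical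
  rcases le_or_gt m n with hmn | hmn
  · have h1 := (card_countGE_gt_count_one_le (n - m) hm).trans (card_exists_countGE_eq_le _ m)
    rw [← card_le_count_one_sub hmn, ← card_le_count_one_sub hmn] at h1
    have h2 : {s ∈ partitions n | m ≤ s.count 1} ⊆
        {s ∈ partitions n | m + countGE s (s.count 1 + 1) ≤ s.count 1} ∪
        {s ∈ partitions n | m ≤ s.count 1 ∧ (s - Multiset.replicate m 1).count 1 + 1 ≤
          countGE (s - Multiset.replicate m 1)
            (m + (s - Multiset.replicate m 1).count 1 + 1)} := by
      intro s hs
      rw [← filter_or, mem_filter]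
      rw [mem_filter] at hs
      refine ⟨hs.1, ?_⟩
      have h3 := countGE_sub_add (Multiset.le_count_iff_replicate_le.1 hs.2) (s.count 1 + 1)
      rw [countGE_replicate_one m (by omega), add_zero] at h3
      rw [Multiset.count_sub, Multiset.count_replicate_self,
        Nat.add_sub_cancel' hs.2, h3]
      omega
    have h4 : #{s ∈ partitions n | m ≤ s.count 1 ∧
        m + 1 ≤ (s - Multiset.replicate m 1).count 1} =
        #{s ∈ partitions n | 2 * m + 1 ≤ s.count 1} := by
      congr 1
      refine filter_congr fun s _ => ?_
      rw [Multiset.count_sub, Multiset.count_replicate_self]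
      omega
    rw [h4] at h1
    have := (card_le_card h2).trans (card_union_le _ _)
    omega
  · rw [card_eq_zero.2 (filter_eq_empty_iff.2 fun s hs => ?_)]
    · exact Nat.zero_le _
    · rw [mem_partitions] at hs
      have := card_le_sum hs.1
      have := s.count_le_card 1
      omega

lemma count_one_le {n : ℕ} {s : Multiset ℕ} (hs : s ∈ partitions n) : s.count 1 ≤ n := by
  rw [mem_partitions] at hs
  exact (s.count_le_card 1).trans ((card_le_sum hs.1).trans hs.2.le)

lemma sum_count_eq_sum_card (j : ℕ) (A : Finset (Multiset ℕ)) {K : ℕ}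
    (hK : ∀ s ∈ A, s.count j ≤ K) :
    ∑ s ∈ A, s.count j = ∑ k ∈ Icc 1 K, #{s ∈ A | k ≤ s.count j} := by
  simp only [card_filter]
  rw [sum_comm]
  refine sum_congr rfl fun s hs => ?_
  rw [← card_filter]
  have : {k ∈ Icc 1 K | k ≤ s.count j} = Icc 1 (s.count j) := by
    ext k
    have := hK s hs
    simp only [mem_filter, mem_Icc]
    omega
  rw [this]
  simp

lemma card_mem_eq (n : ℕ) {j : ℕ} (hj : 1 ≤ j) :
    #{s ∈ partitions n | j ∈ s} = #{s ∈ partitions n | j ≤ s.count 1} := by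
  have := sum_sub_eq_sum_sub n (r := {j}) (r' := Multiset.replicate j 1)
    (fun x hx => by rw [Multiset.mem_singleton.1 hx]; exact hj)
    pos_of_mem_replicate_one (by simp) (fun _ => 1)
  simpa only [← card_eq_sum_ones, Multiset.singleton_le, ← Multiset.le_count_iff_replicate_le]
    using this

lemma card_count_two (n i : ℕ) :
    #{s ∈ partitions n | s.count 1 = 0 ∧ i ≤ s.count 2} +
      #{s ∈ partitions n | 2 * i + 1 ≤ s.count 1} = #{s ∈ partitions n | 2 * i ≤ s.count 1} := by
  have h2 : ∀ x ∈ Multiset.replicate i 2, 0 < x := fun x hx => by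
    rw [Multiset.eq_of_mem_replicate hx]
    exact two_pos
  have hsum : (Multiset.replicate i 2).sum = (Multiset.replicate (2 * i) 1).sum := by
    simp [mul_comm]
  have hall := sum_sub_eq_sum_sub n h2 pos_of_mem_replicate_one hsum (fun _ => 1)
  have hone := sum_sub_eq_sum_sub n h2 pos_of_mem_replicate_one hsum
    (fun u => if 1 ≤ u.count 1 then 1 else 0)
  simp only [← card_filter, ← card_eq_sum_ones, filter_filter,
    ← Multiset.le_count_iff_replicate_le, Multiset.count_sub, Multiset.count_replicate_self,
    Multiset.count_replicate] at hall hone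
  have hl : #{s ∈ partitions n | 2 * i + 1 ≤ s.count 1} =
      #{s ∈ partitions n | i ≤ s.count 2 ∧ 1 ≤ s.count 1} := by
    simp only [OfNat.ofNat_ne_one, if_false, tsub_zero] at hone
    rw [hone]
    congr 1
    refine filter_congr fun s _ => ?_
    omega
  rw [hl, ← hall, ← card_union_of_disjoint, ← filter_or]
  · congr 1
    refine filter_congr fun s _ => ?_
    omega
  · refine disjoint_filter.2 fun s _ h h' => ?_
    omega

/-- The smallest element of `s`, and `0` if `s` is empty. -/
def smallest (s : Multiset ℕ) : ℕ := (s.sort (· ≤ ·)).headD 0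

lemma smallest_le {s : Multiset ℕ} {x : ℕ} (hx : x ∈ s) : smallest s ≤ x := by
  have hsort := s.pairwise_sort (· ≤ ·)
  rw [← Multiset.mem_sort (· ≤ ·)] at hx
  unfold smallest
  cases hL : s.sort (· ≤ ·) with
  | nil => simp
  | cons a L =>
    rw [hL] at hx hsort
    rcases List.mem_cons.1 hx with rfl | hx
    · exact le_rfl
    · exact (List.pairwise_cons.1 hsort).1 x hx

lemma smallest_mem {s : Multiset ℕ} (hs : s ≠ 0) : smallest s ∈ s := by
  rw [← Multiset.mem_sort (· ≤ ·)]
  unfold smallest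
  cases hL : s.sort (· ≤ ·) with
  | nil => exact absurd (by simpa [hL] using (s.sort_eq (· ≤ ·)).symm) hs
  | cons a L => simp

/-- Turn `i` of the parts equal to `j` into `j - 1`, and insert `i` parts equal to `1`. -/
def splitOnes (j i : ℕ) (s : Multiset ℕ) : Multiset ℕ :=
  s - Multiset.replicate i j + Multiset.replicate i (j - 1) + Multiset.replicate i 1

lemma smallest_le_of_splitOnes_eq {s t : Multiset ℕ} {i : ℕ} (hi : 1 ≤ i)
    (hs : 3 ≤ smallest s) (h : splitOnes (smallest s) i s = splitOnes (smallest t) i t) :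
    smallest t ≤ smallest s := by
  have hmem : smallest s - 1 ∈ splitOnes (smallest s) i s :=
    Multiset.mem_add.2 <| .inl <| Multiset.mem_add.2 <| .inr <|
      Multiset.mem_replicate.2 ⟨by omega, rfl⟩
  rw [h, splitOnes, Multiset.mem_add, Multiset.mem_add] at hmem
  rcases hmem with (h1 | h1) | h1
  · have := smallest_le (Multiset.mem_of_le (Multiset.sub_le_self _ _) h1)
    omega
  · have := Multiset.eq_of_mem_replicate h1
    omega
  · have := Multiset.eq_of_mem_replicate h1
    omega

lemma sum_count_smallest_le (n : ℕ) :
    ∑ s ∈ partitions n with s.count 1 = 0 ∧ s.count 2 = 0, s.count (smallest s) ≤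
      #{s ∈ partitions n | 1 ≤ s.count 1} := by
  have hcard : ∑ s ∈ partitions n with s.count 1 = 0 ∧ s.count 2 = 0, s.count (smallest s) =
      #({s ∈ partitions n | s.count 1 = 0 ∧ s.count 2 = 0}.sigma
        fun s => Icc 1 (s.count (smallest s))) := by
    simp [card_sigma]
  have three_le : ∀ {s : Multiset ℕ}, s ∈ partitions n → s.count 1 = 0 → s.count 2 = 0 →
      1 ≤ s.count (smallest s) → 3 ≤ smallest s := by
    intro s hs h1 h2 h
    have hmem := Multiset.one_le_count_iff_mem.1 h
    have h0 := (mem_partitions.1 hs).1 _ hmem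
    have h1' : smallest s ≠ 1 := fun h' => Multiset.count_eq_zero.1 h1 (h' ▸ hmem)
    have h2' : smallest s ≠ 2 := fun h' => Multiset.count_eq_zero.1 h2 (h' ▸ hmem)
    omega
  have count_split : ∀ {s : Multiset ℕ} {j i : ℕ}, s.count 1 = 0 → 3 ≤ j →
      (splitOnes j i s).count 1 = i := by
    intro s j i h hj
    have hr : (Multiset.replicate i (j - 1)).count 1 = 0 :=
      Multiset.count_eq_zero_of_notMem fun h1 => by
        have := Multiset.eq_of_mem_replicate h1
        omega
    rw [splitOnes, Multiset.count_add, Multiset.count_add, Multiset.count_sub, h, hr,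
      Multiset.count_replicate_self, zero_tsub, zero_add, zero_add]
  rw [hcard]
  refine card_le_card_of_injOn (fun x => splitOnes (smallest x.1) x.2 x.1) ?_ ?_
  · rintro ⟨s, i⟩ hs
    simp only [mem_coe, mem_sigma, mem_filter, mem_Icc] at hs ⊢
    obtain ⟨⟨hs, h1, h2⟩, hi, his⟩ := hs
    have h3 := three_le hs h1 h2 (hi.trans his)
    rw [mem_partitions] at hs
    refine ⟨mem_partitions.2 ⟨fun x hx => ?_, ?_⟩, by rwa [count_split h1 h3]⟩
    · rw [splitOnes, Multiset.mem_add, Multiset.mem_add] at hx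
      rcases hx with (hx | hx) | hx
      · exact hs.1 x (Multiset.mem_of_le (Multiset.sub_le_self _ _) hx)
      · rw [Multiset.eq_of_mem_replicate hx]
        omega
      · exact pos_of_mem_replicate_one x hx
    · have := congrArg Multiset.sum
        (tsub_add_cancel_of_le (Multiset.le_count_iff_replicate_le.1 his))
      simp only [Multiset.sum_add, Multiset.sum_replicate, smul_eq_mul, splitOnes] at this ⊢
      have hmul : i * smallest s = i * (smallest s - 1) + i * 1 := by
        rw [← mul_add, Nat.sub_add_cancel (by omega)]
      have := hs.2
      omega
  · rintro ⟨s, i⟩ hs ⟨t, k⟩ ht h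
    simp only [mem_coe, mem_sigma, mem_filter, mem_Icc] at hs ht h
    obtain ⟨⟨hs, hs1, hs2⟩, hi, his⟩ := hs
    obtain ⟨⟨ht, ht1, ht2⟩, hk, hkt⟩ := ht
    have hs3 := three_le hs hs1 hs2 (hi.trans his)
    have ht3 := three_le ht ht1 ht2 (hk.trans hkt)
    obtain rfl : i = k := by
      have := congrArg (Multiset.count 1) h
      rwa [count_split hs1 hs3, count_split ht1 ht3] at this
    have hst : smallest s = smallest t :=
      (smallest_le_of_splitOnes_eq hi ht3 h.symm).antisymm
        (smallest_le_of_splitOnes_eq hi hs3 h)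
    rw [Multiset.le_count_iff_replicate_le] at his hkt
    rw [hst] at h his
    have := add_right_cancel (add_right_cancel h)
    obtain rfl : s = t := by
      rw [← tsub_add_cancel_of_le his, this, tsub_add_cancel_of_le hkt]
    rfl

lemma sum_count_smallest_eq {n : ℕ} (hn : 1 ≤ n) :
    ∑ s ∈ partitions n, s.count (smallest s) =
      ∑ s ∈ partitions n, s.count 1 + ∑ s ∈ partitions n with s.count 1 = 0, s.count 2 +
      ∑ s ∈ partitions n with s.count 1 = 0 ∧ s.count 2 = 0, s.count (smallest s) := by
  rw [sum_filter, sum_filter, ← sum_add_distrib, ← sum_add_distrib]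
  refine sum_congr rfl fun s hs => ?_
  rw [mem_partitions] at hs
  have hmem : smallest s ∈ s := smallest_mem fun h => by
    rw [h, Multiset.sum_zero] at hs
    omega
  have hpos := hs.1 _ hmem
  by_cases h1 : s.count 1 = 0
  · by_cases h2 : s.count 2 = 0
    · simp [h1, h2]
    · have hle := smallest_le (Multiset.count_ne_zero.1 h2)
      have hne : smallest s ≠ 1 := fun h => Multiset.count_eq_zero.1 h1 (h ▸ hmem)
      rw [show smallest s = 2 by omega]
      simp [h1, h2]
  · have hle := smallest_le (Multiset.count_ne_zero.1 h1)
    rw [show smallest s = 1 by omega]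
    simp [h1]

/-- The crank of the partition with multiset of parts `s`; the largest part is the number of
parts of the conjugate partition. -/
def crank (s : Multiset ℕ) : ℤ :=
  if s.count 1 = 0 then (countGE (conj s) 1 : ℤ)
  else (countGE s (s.count 1 + 1) : ℤ) - s.count 1

lemma part_one_eq {n : ℕ} (l : n.Partition) :
    RankCrank.part l 1 = countGE (conj l.parts) 1 := by
  have hsort := l.parts.pairwise_sort (· ≤ ·)
  rw [← List.pairwise_reverse] at hsort
  have hmem : ∀ x, x ∈ (l.parts.sort (· ≤ ·)).reverse ↔ x ∈ l.parts := fun x => by simp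
  refine eq_of_forall_le_iff fun c => ?_
  rcases Nat.eq_zero_or_pos c with rfl | hc
  · simp
  rw [le_countGE_conj _ le_rfl hc, countGE, Nat.one_le_iff_ne_zero, ← Nat.pos_iff_ne_zero,
    Multiset.countP_pos, RankCrank.part]
  cases hL : (l.parts.sort (· ≤ ·)).reverse with
  | nil =>
    simp only [hL, List.not_mem_nil, false_iff] at hmem
    simp only [Nat.sub_self, List.getD_nil, hmem, false_and, exists_false, iff_false]
    omega
  | cons a L =>
    rw [hL] at hmem hsort
    simp only [Nat.sub_self, List.getD_cons_zero]
    refine ⟨fun h => ⟨a, (hmem a).1 List.mem_cons_self, h⟩, ?_⟩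
    rintro ⟨x, hx, hcx⟩
    rcases List.mem_cons.1 ((hmem x).2 hx) with rfl | hx
    · exact hcx
    · exact hcx.trans ((List.pairwise_cons.1 hsort).1 x hx)

lemma crank_parts {n : ℕ} (l : n.Partition) : RankCrank.crank l = crank l.parts := by
  simp only [RankCrank.crank, crank, part_one_eq, countGE, Multiset.countP_eq_card_filter]
  rfl

lemma sum_count_of_count_one_lt (n : ℕ) {j : ℕ} (hj : 2 ≤ j) :
    ∑ s ∈ partitions n with s.count 1 < j, s.count j = #{s ∈ partitions n | j ≤ s.count 1} := by
  have key := sum_sub_eq_sum_sub n (r := {j}) (r' := Multiset.replicate j 1)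
    (fun x hx => by rw [Multiset.mem_singleton.1 hx]; omega)
    pos_of_mem_replicate_one (by simp) (Multiset.count j)
  have hr : ∀ s : Multiset ℕ, (s - Multiset.replicate j 1).count j = s.count j := fun s => by
    rw [Multiset.count_sub, Multiset.count_replicate, if_neg (by omega), Nat.sub_zero]
  simp only [hr, Multiset.singleton_le, ← Multiset.le_count_iff_replicate_le] at key
  have hmem : ∑ s ∈ partitions n with j ∈ s, s.count j =
      ∑ s ∈ partitions n with j ∈ s, (s - {j}).count j + #{s ∈ partitions n | j ∈ s} := by
    rw [card_eq_sum_ones, ← sum_add_distrib]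
    refine sum_congr rfl fun s hs => ?_
    have := Multiset.one_le_count_iff_mem.2 (mem_filter.1 hs).2
    rw [Multiset.count_sub, Multiset.count_singleton_self]
    omega
  have hall : ∑ s ∈ partitions n with j ∈ s, s.count j = ∑ s ∈ partitions n, s.count j :=
    sum_filter_of_ne fun s _ h => Multiset.count_ne_zero.1 h
  have hsplit : ∑ s ∈ partitions n with s.count 1 < j, s.count j +
      ∑ s ∈ partitions n with j ≤ s.count 1, s.count j = ∑ s ∈ partitions n, s.count j := by
    simp only [sum_filter]
    rw [← sum_add_distrib]
    refine sum_congr rfl fun s _ => ?_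
    split_ifs <;> omega
  rw [card_mem_eq n (by omega : 1 ≤ j)] at hmem
  omega

lemma sum_countGE_count_one (n : ℕ) :
    ∑ s ∈ partitions n, countGE s (s.count 1 + 1) =
      ∑ j ∈ Icc 2 n, #{s ∈ partitions n | j ≤ s.count 1} := by
  rw [← sum_congr rfl fun j hj => sum_count_of_count_one_lt n (mem_Icc.1 hj).1]
  simp only [sum_filter]
  rw [sum_comm]
  refine sum_congr rfl fun s hs => ?_
  rw [← sum_filter]
  have hK : ∀ x ∈ s, x ≤ n := fun x hx =>
    (Multiset.le_sum_of_mem hx).trans (mem_partitions.1 hs).2.le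
  rcases Nat.eq_zero_or_pos (s.count 1) with h0 | h0
  · rw [h0, countGE_eq_count_add, h0, zero_add, countGE_eq_sum_count s hK]
    refine sum_congr ?_ fun _ _ => rfl
    ext j
    simp only [mem_filter, mem_Icc]
    omega
  · rw [countGE_eq_sum_count s hK]
    refine sum_congr ?_ fun _ _ => rfl
    ext j
    simp only [mem_filter, mem_Icc]
    omega

lemma sum_countGE_conj {n : ℕ} (hn : 2 ≤ n) :
    ∑ s ∈ partitions n with s.count 1 = 0, countGE (conj s) 1 =
      ∑ s ∈ partitions n with s.count 1 = 0, countGE s 1 +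
        #{s ∈ partitions n | 1 ≤ s.count 1} := by
  have h1 : ∀ x ∈ ({1} : Multiset ℕ), 0 < x := by simp
  have key := sum_sub_eq_sum_conj_sub n h1 h1 rfl (fun s => countGE s 1)
  have hall := sum_comp_conj n (fun s => countGE s 1)
  have hleft : ∑ s ∈ partitions n with {1} ≤ s, countGE s 1 =
      ∑ s ∈ partitions n with {1} ≤ s, countGE (s - {1}) 1 +
        #{s ∈ partitions n | {1} ≤ s} := by
    rw [card_eq_sum_ones, ← sum_add_distrib]
    refine sum_congr rfl fun s hs => ?_
    rw [← countGE_sub_add (mem_filter.1 hs).2 1, countGE_singleton, if_pos le_rfl]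
  have hright : ∑ s ∈ partitions n with {1} ≤ s, countGE (conj (s - {1})) 1 =
      ∑ s ∈ partitions n with {1} ≤ s, countGE (conj s) 1 := by
    refine sum_congr rfl fun s hs => eq_of_forall_le_iff fun c => ?_
    rw [mem_filter, mem_partitions] at hs
    have hsub := countGE_sub_add hs.2 c
    rw [countGE_singleton] at hsub
    rcases lt_trichotomy c 1 with hc | rfl | hc
    · simp [Nat.lt_one_iff.1 hc]
    · rw [le_countGE_conj _ le_rfl le_rfl, le_countGE_conj _ le_rfl le_rfl]
      have hpos : ∀ x ∈ s - {1}, 0 < x := fun x hx =>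
        hs.1.1 x (Multiset.mem_of_le (Multiset.sub_le_self _ _) hx)
      have hne : countGE (s - {1}) 1 ≠ 0 := fun h0 => by
        rw [countGE_one hpos, Multiset.card_eq_zero] at h0
        have h2 := congrArg Multiset.sum (tsub_add_cancel_of_le hs.2)
        rw [h0, zero_add, Multiset.sum_singleton, hs.1.2] at h2
        omega
      rw [if_pos le_rfl] at hsub
      omega
    · rw [le_countGE_conj _ le_rfl hc.le, le_countGE_conj _ le_rfl hc.le]
      rw [if_neg (by omega)] at hsub
      omega
  have hsplit := fun f : Multiset ℕ → ℕ =>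
    sum_filter_add_sum_filter_not (partitions n) (fun s => {1} ≤ s) f
  have hsplit1 := hsplit fun s => countGE s 1
  have hsplit2 := hsplit fun s => countGE (conj s) 1
  have hiff : ∀ s : Multiset ℕ, ¬ {1} ≤ s ↔ s.count 1 = 0 := fun s => by
    rw [Multiset.singleton_le, Multiset.count_eq_zero]
  have hiff' : ∀ s : Multiset ℕ, {1} ≤ s ↔ 1 ≤ s.count 1 := fun s => by
    rw [Multiset.singleton_le, Multiset.one_le_count_iff_mem]
  simp only [hiff] at hsplit1 hsplit2
  simp only [hiff'] at hsplit1 hsplit2 hleft hright key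
  omega

lemma sum_count_one (n : ℕ) {K : ℕ} (hK : n ≤ K) :
    ∑ s ∈ partitions n, s.count 1 = ∑ k ∈ Icc 1 K, #{s ∈ partitions n | k ≤ s.count 1} :=
  sum_count_eq_sum_card 1 _ fun _ hs => (count_one_le hs).trans hK

lemma sum_crank {n : ℕ} (hn : 2 ≤ n) : ∑ s ∈ partitions n, crank s = 0 := by
  have hcrank : ∀ s, crank s = (if s.count 1 = 0 then (countGE (conj s) 1 : ℤ) else 0) -
      (if s.count 1 = 0 then (countGE s 1 : ℤ) else 0) + countGE s (s.count 1 + 1) -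
        s.count 1 := by
    intro s
    rw [crank]
    split_ifs with h
    · simp [h]
    · simp
  have h1 := sum_countGE_conj hn
  have h2 := sum_countGE_count_one n
  have h3 := sum_count_one n le_rfl
  rw [← add_sum_Ioc_eq_sum_Icc (by omega : 1 ≤ n),
    show Ioc 1 n = Icc 2 n from by ext; simp only [mem_Ioc, mem_Icc]; omega] at h3
  replace h1 := congrArg (Nat.cast : ℕ → ℤ) h1
  replace h2 := congrArg (Nat.cast : ℕ → ℤ) h2
  replace h3 := congrArg (Nat.cast : ℕ → ℤ) h3
  simp only [Nat.cast_sum, Nat.cast_add] at h1 h2 h3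
  rw [sum_congr rfl fun s _ => hcrank s, sum_sub_distrib, sum_add_distrib, sum_sub_distrib,
    ← sum_filter, ← sum_filter]
  linarith

lemma crank_add_two_mul_le_abs (n : ℕ) (s : Multiset ℕ) :
    crank s + 2 * #{m ∈ Icc 1 n | m + countGE s (s.count 1 + 1) ≤ s.count 1} ≤ |crank s| := by
  have hle : #{m ∈ Icc 1 n | m + countGE s (s.count 1 + 1) ≤ s.count 1} ≤
      s.count 1 - countGE s (s.count 1 + 1) := by
    refine (card_le_card (t := Icc 1 (s.count 1 - countGE s (s.count 1 + 1)))
      fun m hm => ?_).trans (by simp)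
    simp only [mem_filter, mem_Icc] at hm ⊢
    omega
  rw [crank]
  split_ifs with h
  · have := le_abs_self (countGE (conj s) 1 : ℤ)
    omega
  · have := le_abs_self ((countGE s (s.count 1 + 1) : ℤ) - s.count 1)
    have := neg_le_abs ((countGE s (s.count 1 + 1) : ℤ) - s.count 1)
    omega

lemma sum_Icc_even_add_odd (f : ℕ → ℕ) (n : ℕ) :
    ∑ m ∈ Icc 1 n, f (2 * m) + ∑ m ∈ Icc 1 n, f (2 * m + 1) + f 1 =
      ∑ k ∈ Icc 1 (2 * n + 1), f k := by
  induction n with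
  | zero => simp
  | succ n ih =>
    rw [sum_Icc_succ_top (by omega), sum_Icc_succ_top (by omega),
      show 2 * (n + 1) + 1 = 2 * n + 1 + 1 + 1 by ring, sum_Icc_succ_top (by omega),
      sum_Icc_succ_top (by omega), ← ih, show 2 * (n + 1) = 2 * n + 1 + 1 by ring]
    ring

lemma sum_count_smallest_le_two_mul {n : ℕ} (hn : 1 ≤ n) :
    ∑ s ∈ partitions n, s.count (smallest s) ≤
      2 * ∑ m ∈ Icc 1 n,
        #{s ∈ partitions n | m + countGE s (s.count 1 + 1) ≤ s.count 1} := by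
  have h1 := sum_count_smallest_eq hn
  have h2 := sum_count_smallest_le n
  have h3 := sum_count_eq_sum_card 2 {s ∈ partitions n | s.count 1 = 0} (K := n) fun s hs => by
    rw [mem_filter, mem_partitions] at hs
    exact (s.count_le_card 2).trans ((card_le_sum hs.1.1).trans hs.1.2.le)
  simp only [filter_filter] at h3
  have h4 := sum_congr rfl fun i (_ : i ∈ Icc 1 n) => card_count_two n i
  rw [sum_add_distrib] at h4
  have h5 := sum_le_sum fun m (hm : m ∈ Icc 1 n) => card_le_count_one_le n (mem_Icc.1 hm).1
  rw [sum_add_distrib] at h5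
  have h6 := sum_Icc_even_add_odd (fun k => #{s ∈ partitions n | k ≤ s.count 1}) n
  rw [← sum_count_one n (by omega)] at h6
  rw [← sum_count_one n le_rfl] at h5
  omega

end PartitionMultiset

open RankCrank in
/-- For every `n ≥ 1`, `spt n` is at most the sum of `|crank λ|` over all
partitions `λ` of `n`. -/
theorem spt_le_sum_abs_crank (n : ℕ) (hn : 1 ≤ n) :
    (spt n : ℤ) ≤ ∑ l : n.Partition, |crank l| := by
  obtain rfl | hn2 := hn.eq_or_lt
  · simp [spt, crank, Multiset.filter_singleton]
  have hspt : spt n = ∑ s ∈ PartitionMultiset.partitions n,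
      s.count (PartitionMultiset.smallest s) :=
    PartitionMultiset.sum_partition n fun s => s.count (PartitionMultiset.smallest s)
  have hcrank : ∑ l : n.Partition, |crank l| =
      ∑ s ∈ PartitionMultiset.partitions n, |PartitionMultiset.crank s| := by
    rw [← PartitionMultiset.sum_partition]
    exact Finset.sum_congr rfl fun l _ => by rw [PartitionMultiset.crank_parts]
  have hle := Finset.sum_le_sum fun s (_ : s ∈ PartitionMultiset.partitions n) =>
    PartitionMultiset.crank_add_two_mul_le_abs n s
  rw [Finset.sum_add_distrib, PartitionMultiset.sum_crank hn2, zero_add, ← Finset.mul_sum] at hle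
  have h := PartitionMultiset.sum_count_smallest_le_two_mul hn
  simp only [Finset.card_filter] at h hle
  rw [Finset.sum_comm] at h
  rw [hspt, hcrank]
  refine le_trans ?_ hle
  exact_mod_cast h
end
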